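/- Let X be a shift space over a finite alphabet with language 𝓛 = 𝓛(X), and let φ : X → ℝ be continuous. Suppose there is 𝓖 ⊂ 𝓛 having (W)-specification and that 𝓛 is edit approachable by 𝓖. Then for any compact connected non-empty subset K of the space M_σ(X) of σ-invariant Borel probability measures, the topological pressure of the saturated set G_K(X,σ) satisfies P_{G_K(X,σ)}(φ) = inf_{μ∈K} { h_μ(σ) + ∫ φ dμ }. -/

import Mathlib

open MeasureTheory Filter Topology Set
open scoped ENNReal Classical

namespace Paper

variable {A : Type} [Fintype A] [DecidableEq A] [TopologicalSpace A] [DiscreteTopology A]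
  [MeasurableSpace A] [BorelSpace A]

/-- The left shift map on the full shift `A^ℕ`. -/
def shift : (ℕ → A) → (ℕ → A) := fun x i => x (i + 1)

/-- The cylinder set of a finite word `w`: points whose initial word is `w`. -/
def cylinder (w : List A) : Set (ℕ → A) := {x | ∀ i : Fin w.length, x i = w.get i}

/-- The language of `X`: finite words `w` with `[w] ∩ X ≠ ∅`. -/
def language (X : Set (ℕ → A)) : Set (List A) := {w | (cylinder w ∩ X).Nonempty}

/-- One edit of a word: a substitution, an insertion, or a deletion. -/
def EditStep (w w' : List A) : Prop :=
  (∃ u₁ u₂ : List A, ∃ a a' : A, w = u₁ ++ [a] ++ u₂ ∧ w' = u₁ ++ [a'] ++ u₂) ∨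
  (∃ u₁ u₂ : List A, ∃ a' : A, w = u₁ ++ u₂ ∧ w' = u₁ ++ [a'] ++ u₂) ∨
  (∃ u₁ u₂ : List A, ∃ a : A, w = u₁ ++ [a] ++ u₂ ∧ w' = u₁ ++ u₂)

/-- The edit distance: the minimal number of edits transforming `v` into `w`. -/
noncomputable def editDist (v w : List A) : ℕ :=
  sInf {n | ∃ f : ℕ → List A, f 0 = v ∧ f n = w ∧ ∀ i < n, EditStep (f i) (f (i + 1))}

/-- `G ⊆ L` has (W)-specification (with some gap length `τ`). -/
def HasSpecW (L G : Set (List A)) : Prop :=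
  ∃ τ : ℕ, ∀ v ∈ G, ∀ w ∈ G, ∃ u ∈ L, u.length ≤ τ ∧ v ++ u ++ w ∈ G

/-- A mistake function: nondecreasing with `g n / n → 0`. -/
def MistakeFun (g : ℕ → ℕ) : Prop :=
  Monotone g ∧ Tendsto (fun n => (g n : ℝ) / n) atTop (𝓝 0)

/-- `L` is edit approachable by `G`. -/
def EditApproachable (L G : Set (List A)) : Prop :=
  ∃ g : ℕ → ℕ, MistakeFun g ∧ ∀ w ∈ L, ∃ v ∈ G, editDist v w ≤ g w.length

/-- The shift map restricted to a (shift-invariant) subset `X`, as a self-map of `↥X`. -/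
noncomputable def subShift (X : Set (ℕ → A)) : ↥X → ↥X := fun x =>
  if h : shift x.val ∈ X then ⟨shift x.val, h⟩ else x

/-- Birkhoff sum `S_n φ = ∑_{i<n} φ ∘ σ^i`. -/
def birkhoff {Y : Type*} (σ : Y → Y) (φ : Y → ℝ) (n : ℕ) (y : Y) : ℝ :=
  ∑ i ∈ Finset.range n, φ (σ^[i] y)

/-- The Birkhoff average `(1/n) S_n φ`. -/
noncomputable def birkAvg {Y : Type*} (σ : Y → Y) (φ : Y → ℝ) (n : ℕ) (y : Y) : ℝ :=
  (n : ℝ)⁻¹ * birkhoff σ φ n y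

/-- Carathéodory sum `M(Z,t,φ,N)` over covers of `Z` by cylinders of length `> N`. -/
noncomputable def Mcal (X : Set (ℕ → A)) (φ : ↥X → ℝ) (Z : Set ↥X) (t : ℝ) (N : ℕ) : ℝ≥0∞ :=
  ⨅ (S : Set (List A)) (_ : S.Countable) (_ : ∀ w ∈ S, N < w.length)
    (_ : Z ⊆ ⋃ w ∈ S, Subtype.val ⁻¹' cylinder w),
    ∑' w : S, ENNReal.ofReal (Real.exp (-t * (w : List A).length +
      sSup (birkhoff (subShift X) φ (w : List A).length ''
        (Subtype.val ⁻¹' cylinder (w : List A)))))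

/-- `M(Z,t,φ) = lim_{N→∞} M(Z,t,φ,N)` (the limit of a nondecreasing quantity). -/
noncomputable def McalLim (X : Set (ℕ → A)) (φ : ↥X → ℝ) (Z : Set ↥X) (t : ℝ) : ℝ≥0∞ :=
  ⨆ N : ℕ, Mcal X φ Z t N

/-- The topological pressure `P_Z(φ)` of `Z ⊆ X`. -/
noncomputable def pressure (X : Set (ℕ → A)) (φ : ↥X → ℝ) (Z : Set ↥X) : ℝ :=
  sInf {t : ℝ | McalLim X φ Z t = 0}

/-- The empirical measure `ℰ_n(x) = (1/n) ∑_{i<n} δ_{σ^i x}`. -/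
noncomputable def empiric {Y : Type*} [MeasurableSpace Y] (σ : Y → Y) (n : ℕ) (x : Y) :
    Measure Y := (n : ℝ≥0∞)⁻¹ • ∑ i ∈ Finset.range n, Measure.dirac (σ^[i] x)

/-- The set `A(ℰ_n(x))` of weak* limit points of the sequence of empirical measures of `x`:
probability measures that are limits of the empirical measures along a subsequence. -/
def limitPts {Y : Type*} [MeasurableSpace Y] [TopologicalSpace Y] (σ : Y → Y) (x : Y) :
    Set (ProbabilityMeasure Y) :=
  {μ | ∃ φ : ℕ → ℕ, StrictMono φ ∧ ∀ f : C(Y, ℝ),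
      Tendsto (fun k => birkAvg σ (fun y => f y) (φ k) x) atTop (𝓝 (∫ y, f y ∂μ.toMeasure))}

/-- The saturated set `G_K = {x : A(ℰ_n(x)) = K}`. -/
def saturated {Y : Type*} [MeasurableSpace Y] [TopologicalSpace Y] (σ : Y → Y)
    (K : Set (ProbabilityMeasure Y)) : Set Y := {x | limitPts σ x = K}

/-- The generic points of `μ`: those `x` with `ℰ_n(x) → μ` in the weak* topology. -/
def genericPts {Y : Type*} [MeasurableSpace Y] [TopologicalSpace Y] (σ : Y → Y)
    (μ : ProbabilityMeasure Y) : Set Y :=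
  {x | ∀ f : C(Y, ℝ),
      Tendsto (fun n => birkAvg σ (fun y => f y) n x) atTop (𝓝 (∫ y, f y ∂μ.toMeasure))}

/-- `μ` is a `σ`-invariant (probability) measure. -/
def IsInvariant {Y : Type*} [MeasurableSpace Y] (σ : Y → Y) (μ : ProbabilityMeasure Y) : Prop :=
  μ.toMeasure.map σ = μ.toMeasure

/-- The level set `X(ψ,α)` of points whose Birkhoff averages of `ψ` converge to `α`. -/
def levelSet {Y : Type*} (σ : Y → Y) (ψ : Y → ℝ) (α : ℝ) : Set Y :=
  {x | Tendsto (fun n => birkAvg σ ψ n x) atTop (𝓝 α)}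

/-- The irregular set `X̂(ψ)` of points whose Birkhoff averages of `ψ` do not converge. -/
def irregular {Y : Type*} (σ : Y → Y) (ψ : Y → ℝ) : Set Y :=
  {x | ¬ ∃ α : ℝ, Tendsto (fun n => birkAvg σ ψ n x) atTop (𝓝 α)}

/-- The cylinder of a word of length `n` given as `w : Fin n → A`. -/
def cylF {n : ℕ} (w : Fin n → A) : Set (ℕ → A) := {x | ∀ i : Fin n, x i = w i}

/-- The entropy `H_n(μ)` of the partition of `X` into cylinders of length `n`. -/
noncomputable def wordEntropy (X : Set (ℕ → A)) (μ : ProbabilityMeasure ↥X) (n : ℕ) : ℝ :=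
  ∑ w : Fin n → A, Real.negMulLog ((μ.toMeasure (Subtype.val ⁻¹' cylF w)).toReal)

/-- The measure-theoretic (Kolmogorov–Sinai) entropy `h_μ(σ)` of a shift-invariant measure on a
subshift: by subadditivity, `lim_n H_n/n = inf_{n ≥ 1} H_n/n`. -/
noncomputable def entropy (X : Set (ℕ → A)) (μ : ProbabilityMeasure ↥X) : ℝ :=
  ⨅ n : ℕ, wordEntropy X μ (n + 1) / (n + 1)

/-- The distance `D` on measures induced by a countable family of continuous functions. -/
noncomputable def Dmetric {Y : Type*} [MeasurableSpace Y] [TopologicalSpace Y]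
    (f : ℕ → C(Y, ℝ)) (μ ν : Measure Y) : ℝ :=
  ∑' k : ℕ, ((2 : ℝ) ^ (k + 1))⁻¹ * |(∫ y, f k y ∂μ) - ∫ y, f k y ∂ν|

/-- The family `f` is separating: `D` separates Borel probability measures. -/
def Separating {Y : Type*} [MeasurableSpace Y] [TopologicalSpace Y] (f : ℕ → C(Y, ℝ)) : Prop :=
  ∀ μ ν : ProbabilityMeasure Y,
    (∀ k, (∫ y, f k y ∂μ.toMeasure) = ∫ y, f k y ∂ν.toMeasure) → μ = ν

/-- Diameter of a set with respect to a distance function `d`, valued in `ℝ≥0∞`. -/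
noncomputable def ediam {Y : Type*} (d : Y → Y → ℝ) (U : Set Y) : ℝ≥0∞ :=
  ⨆ x ∈ U, ⨆ y ∈ U, ENNReal.ofReal (d x y)

/-- The `s`-dimensional Hausdorff pre-measure at scale `ε` w.r.t. the distance `d`. -/
noncomputable def hMeasAux {Y : Type*} (d : Y → Y → ℝ) (s : ℝ) (ε : ℝ≥0∞) (Z : Set Y) : ℝ≥0∞ :=
  ⨅ (C : ℕ → Set Y) (_ : Z ⊆ ⋃ n, C n) (_ : ∀ n, ediam d (C n) ≤ ε),
    ∑' n, ⨆ (_ : (C n).Nonempty), ediam d (C n) ^ s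

/-- The `s`-dimensional Hausdorff measure w.r.t. the distance `d`. -/
noncomputable def hMeas {Y : Type*} (d : Y → Y → ℝ) (s : ℝ) (Z : Set Y) : ℝ≥0∞ :=
  ⨆ (ε : ℝ≥0∞) (_ : 0 < ε), hMeasAux d s ε Z

/-- The Hausdorff dimension of `Z` w.r.t. the distance `d`. -/
noncomputable def hdim {Y : Type*} (d : Y → Y → ℝ) (Z : Set Y) : ℝ :=
  sInf {s : ℝ | 0 ≤ s ∧ hMeas d s Z = 0}

/-- The length `|x ∧ y|` of the longest common prefix of two distinct points. -/
noncomputable def wedge (x y : ℕ → A) : ℕ := sInf {n | x n ≠ y n}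

/-- The Gatzouras–Peres distance `d_φ` associated with a strictly positive continuous `φ`. -/
noncomputable def dphi (X : Set (ℕ → A)) (φ : ↥X → ℝ) (x y : ↥X) : ℝ :=
  if x = y then 0
  else Real.exp (-(sSup (birkhoff (subShift X) φ (wedge x.val y.val) ''
      {z : ↥X | ∀ i < wedge x.val y.val, z.val i = x.val i})))

/-- The word `w` occurs in `x` at position `k`. -/
def occursAt (w : List A) (x : ℕ → A) (k : ℕ) : Prop :=
  ∀ i : Fin w.length, x (k + i) = w.get i

/-- A shift of finite type: determined by a finite set of forbidden words. -/
def IsSFT {B : Type} (Z : Set (ℕ → B)) : Prop :=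
  ∃ F : Set (List B), F.Finite ∧ Z = {x | ∀ w ∈ F, ∀ k, ¬ occursAt w x k}

/-- A sofic shift: the image of a shift of finite type under a sliding block code. -/
def IsSofic (Y : Set (ℕ → A)) : Prop :=
  ∃ (B : Type) (_ : Fintype B) (Z : Set (ℕ → B)) (π : (ℕ → B) → (ℕ → A)),
    IsSFT Z ∧ Set.MapsTo shift Z Z ∧
    (∃ r : ℕ, ∀ z ∈ Z, ∀ z' ∈ Z, ∀ k, (∀ i ≤ k + r, z i = z' i) → π z k = π z' k) ∧
    (∀ z ∈ Z, π (shift z) = shift (π z)) ∧ π '' Z = Y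

/-- Topological transitivity of a subshift, via its language. -/
def IsTransitive (Y : Set (ℕ → A)) : Prop :=
  ∀ u ∈ language Y, ∀ v ∈ language Y, ∃ w : List A, u ++ w ++ v ∈ language Y

/-- The prefix of length `n` of `x`, as a word. -/
def prefixWord (x : ℕ → A) (n : ℕ) : List A := List.ofFn fun i : Fin n => x i

/-- The norm `‖m‖ = sup_{0 < ‖f‖ ≤ 1} |∫ f dm| / ‖f‖` of a measure on a compact space. -/
noncomputable def mnorm {Y : Type*} [TopologicalSpace Y] [CompactSpace Y] [MeasurableSpace Y]
    (m : Measure Y) : ℝ :=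
  sSup ((fun f : C(Y, ℝ) => |∫ y, f y ∂m| / ‖f‖) '' {f : C(Y, ℝ) | 0 < ‖f‖ ∧ ‖f‖ ≤ 1})

/-- Strict lexicographic order on `ℕ`-indexed sequences of naturals. -/
def lexLt (x y : ℕ → ℕ) : Prop := ∃ n : ℕ, (∀ i < n, x i = y i) ∧ x n < y n

/-- The β-shift: all sequences over `{0, …, b-1}` all of whose shifts are lexicographically
below the expansion `w` of `1` in base `β` (where `b = ⌈β⌉`). -/
def betaShift (b : ℕ) (w : ℕ → ℕ) : Set (ℕ → Fin b) :=
  {x | ∀ j : ℕ, 1 ≤ j → lexLt (fun i => ((shift^[j] x) i : ℕ)) w}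

/-- The S-gap shift: sequences over `{0,1}` such that the number of `0`s between any two
consecutive `1`s lies in `S`. -/
def sGapShift (S : Set ℕ) : Set (ℕ → Fin 2) :=
  {x | ∀ k l : ℕ, k < l → x k = 1 → x l = 1 →
    (∀ m : ℕ, k < m → m < l → x m = 0) → l - k - 1 ∈ S}


section Alignment

variable {B : Type}

/-- `Align v w d`: the words `v` and `w` can be aligned with at most `d` unmatched letters. -/
inductive Align : List B → List B → ℕ → Prop
  | nil (d : ℕ) : Align [] [] d
  | cons (a : B) {v w : List B} {d : ℕ} : Align v w d → Align (a :: v) (a :: w) d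
  | left (a : B) {v w : List B} {d : ℕ} : Align v w d → Align (a :: v) w (d + 1)
  | right (a : B) {v w : List B} {d : ℕ} : Align v w d → Align v (a :: w) (d + 1)

namespace Align

theorem mono {v w : List B} {d e : ℕ} (h : Align v w d) (hde : d ≤ e) : Align v w e := by
  induction h generalizing e with
  | nil d => exact .nil e
  | cons a _ ih => exact .cons a (ih hde)
  | left a _ ih =>
    obtain ⟨e, rfl⟩ : ∃ e', e = e' + 1 := ⟨e - 1, by omega⟩
    exact .left a (ih (by omega))
  | right a _ ih =>
    obtain ⟨e, rfl⟩ : ∃ e', e = e' + 1 := ⟨e - 1, by omega⟩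
    exact .right a (ih (by omega))

theorem refl (v : List B) (d : ℕ) : Align v v d := by
  induction v with
  | nil => exact .nil d
  | cons a v ih => exact .cons a ih

theorem symm {v w : List B} {d : ℕ} (h : Align v w d) : Align w v d := by
  induction h with
  | nil d => exact .nil d
  | cons a _ ih => exact .cons a ih
  | left a _ ih => exact .right a ih
  | right a _ ih => exact .left a ih

theorem append {v w v' w' : List B} {d e : ℕ} (h : Align v w d) (h' : Align v' w' e) :
    Align (v ++ v') (w ++ w') (d + e) := by
  induction h with
  | nil d => exact h'.mono (by omega)
  | cons a _ ih => exact .cons a ih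
  | left a _ ih => exact (Align.left a ih).mono (by omega)
  | right a _ ih => exact (Align.right a ih).mono (by omega)

theorem nil_right (v : List B) : Align v [] v.length := by
  induction v with
  | nil => exact .nil 0
  | cons a v ih => exact .left a ih

theorem append_left {v w : List B} {d : ℕ} (h : Align v w d) (u : List B) :
    Align (v ++ u) w (d + u.length) := by
  simpa using h.append (nil_right u)

theorem trans {v w z : List B} {d e : ℕ} (h : Align v w d) (h' : Align w z e) :
    Align v z (d + e) := by
  induction h' generalizing v d with
  | nil e => exact h.mono (by omega)
  | @cons a w z e h' ih =>
    generalize hw : a :: w = w' at h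
    induction h with
    | nil => simp at hw
    | cons b h _ =>
      obtain ⟨rfl, rfl⟩ := List.cons.inj hw
      exact .cons _ (ih h)
    | left b h ih' => exact (Align.left b (ih' hw)).mono (by omega)
    | right b h _ =>
      obtain ⟨rfl, rfl⟩ := List.cons.inj hw
      exact (Align.right _ (ih h)).mono (by omega)
  | @left a w z e h' ih =>
    generalize hw : a :: w = w' at h
    induction h with
    | nil => simp at hw
    | cons b h _ =>
      obtain ⟨rfl, rfl⟩ := List.cons.inj hw
      exact (Align.left _ (ih h)).mono (by omega)
    | left b h ih' => exact (Align.left b (ih' hw)).mono (by omega)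
    | right b h _ =>
      obtain ⟨rfl, rfl⟩ := List.cons.inj hw
      exact (ih h).mono (by omega)
  | right a _ ih => exact (Align.right a (ih h)).mono (by omega)

theorem length_le {v w : List B} {d : ℕ} (h : Align v w d) : v.length ≤ w.length + d := by
  induction h with
  | nil d => simp
  | cons a _ ih => simp only [List.length_cons]; omega
  | left a _ ih => simp only [List.length_cons]; omega
  | right a _ ih => simp only [List.length_cons]; omega

theorem of_editStep {v w : List B} (h : EditStep v w) : Align v w 2 := by
  rcases h with ⟨u₁, u₂, a, a', rfl, rfl⟩ | ⟨u₁, u₂, a', rfl, rfl⟩ | ⟨u₁, u₂, a, rfl, rfl⟩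
  · exact ((refl u₁ 0).append (.left a (.right a' (.nil 0)))).append (refl u₂ 0)
  · have := ((refl u₁ 0).append (.right a' (.nil 1))).append (refl u₂ 0)
    simpa using this
  · have := ((refl u₁ 0).append (.left a (.nil 1))).append (refl u₂ 0)
    simpa using this

theorem of_chain (f : ℕ → List B) (n : ℕ) (h : ∀ i < n, EditStep (f i) (f (i + 1))) :
    Align (f 0) (f n) (2 * n) := by
  induction n with
  | zero => exact refl _ _
  | succ n ih => exact (ih fun i hi => h i (by omega)).trans (of_editStep (h n (by omega)))

end Align

theorem exists_editChain_nil (v : List B) :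
    ∃ (n : ℕ) (f : ℕ → List B), f 0 = v ∧ f n = [] ∧ ∀ i < n, EditStep (f i) (f (i + 1)) := by
  refine ⟨v.length, fun i => v.drop i, by simp, by simp, fun i hi => ?_⟩
  refine Or.inr (Or.inr ⟨[], v.drop (i + 1), v[i], ?_, by simp⟩)
  simp

theorem editStep_symm {v w : List B} (h : EditStep v w) : EditStep w v := by
  rcases h with ⟨u₁, u₂, a, a', rfl, rfl⟩ | ⟨u₁, u₂, a', rfl, rfl⟩ | ⟨u₁, u₂, a, rfl, rfl⟩
  · exact Or.inl ⟨u₁, u₂, a', a, rfl, rfl⟩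
  · exact Or.inr (Or.inr ⟨u₁, u₂, a', rfl, rfl⟩)
  · exact Or.inr (Or.inl ⟨u₁, u₂, a, rfl, rfl⟩)

theorem exists_editChain (v w : List B) :
    ∃ (n : ℕ) (f : ℕ → List B), f 0 = v ∧ f n = w ∧ ∀ i < n, EditStep (f i) (f (i + 1)) := by
  obtain ⟨n, f, hf0, hfn, hf⟩ := exists_editChain_nil v
  obtain ⟨m, g, hg0, hgm, hg⟩ := exists_editChain_nil w
  refine ⟨n + m, fun i => if i ≤ n then f i else g (n + m - i), by simp [hf0], ?_, ?_⟩
  · by_cases hm : m = 0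
    · subst hm; simp [hfn, ← hgm, hg0]
    · simp [hm, hg0]
  · intro i hi
    rcases lt_trichotomy i n with h | h | h
    · simpa [h.le, Nat.succ_le_of_lt h] using hf i h
    · subst h
      have := editStep_symm (hg (m - 1) (by omega))
      rw [show m - 1 + 1 = m by omega, hgm] at this
      simpa [hfn, show i + m - (i + 1) = m - 1 by omega] using this
    · have := editStep_symm (hg (n + m - (i + 1)) (by omega))
      rw [show n + m - (i + 1) + 1 = n + m - i by omega] at this
      simpa [show ¬ i ≤ n by omega, show ¬ i + 1 ≤ n by omega] using this

theorem Align.of_editDist_le {A : Type} {v w : List A} {d : ℕ}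
    (h : editDist v w ≤ d) : Align v w (2 * d) := by
  have hne : {n | ∃ f : ℕ → List A, f 0 = v ∧ f n = w ∧
      ∀ i < n, EditStep (f i) (f (i + 1))}.Nonempty := exists_editChain v w
  obtain ⟨f, h0, hn, hf⟩ := Nat.sInf_mem hne
  have := Align.of_chain f _ hf
  rw [h0, hn] at this
  exact this.mono (by unfold editDist at h; omega)

/-- The finite set of words of length `n`. -/
noncomputable def words (B : Type) [Fintype B] (n : ℕ) : Finset (List B) :=
  (Finset.univ : Finset (Fin n → B)).map ⟨List.ofFn, List.ofFn_injective⟩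

theorem mem_words [Fintype B] {n : ℕ} {w : List B} : w ∈ words B n ↔ w.length = n := by
  constructor
  · intro h
    obtain ⟨f, -, rfl⟩ := Finset.mem_map.1 h
    simp
  · rintro rfl
    exact Finset.mem_map.2 ⟨w.get, Finset.mem_univ _, List.ofFn_get w⟩

theorem card_align_le [Fintype B] {x : ℝ} (hx : 0 < x) (hx1 : x ≤ 1) (v : List B) (n d : ℕ) :
    (((words B n).filter fun w => Align v w d).card : ℝ) * x ^ d ≤
      (1 + (Fintype.card B + 1) * x) ^ (v.length + n) := by
  set ρ : ℝ := 1 + (Fintype.card B + 1) * x with hρ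
  have hρ1 : 1 ≤ ρ := by rw [hρ]; nlinarith [show (0 : ℝ) ≤ (Fintype.card B + 1) * x by positivity]
  have hβ : (0 : ℝ) ≤ Fintype.card B := by positivity
  have hins : ∀ (u : List B) (n d : ℕ),
      (((words B n).filter fun w => Align u w d).card : ℝ) * x ^ d ≤ ρ ^ (u.length + n) →
      ((Finset.image₂ List.cons Finset.univ ((words B n).filter fun w => Align u w d)).card : ℝ)
        * x ^ (d + 1) ≤ Fintype.card B * x * ρ ^ (u.length + n) := by
    intro u n d h
    have h1 : ((Finset.image₂ List.cons Finset.univ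
        ((words B n).filter fun w => Align u w d)).card : ℝ) ≤
        Fintype.card B * ((words B n).filter fun w => Align u w d).card := by
      have := Finset.card_image₂_le (List.cons (α := B)) Finset.univ
        ((words B n).filter fun w => Align u w d)
      rw [Finset.card_univ] at this
      exact_mod_cast this
    calc _ ≤ (Fintype.card B * ((words B n).filter fun w => Align u w d).card) * x ^ (d + 1) := by
          gcongr
      _ = Fintype.card B * x * (((words B n).filter fun w => Align u w d).card * x ^ d) := by ring
      _ ≤ _ := by gcongr
  induction v generalizing n d with
  | nil =>
    induction n generalizing d with
    | zero =>
      have h1 : ((words B 0).filter fun w => Align [] w d).card ≤ 1 := by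
        refine Finset.card_le_one.2 fun a ha b hb => ?_
        have h1 := mem_words.1 (Finset.mem_filter.1 ha).1
        have h2 := mem_words.1 (Finset.mem_filter.1 hb).1
        rw [List.length_eq_zero_iff.1 h1, List.length_eq_zero_iff.1 h2]
      have h2 : (((words B 0).filter fun w => Align [] w d).card : ℝ) ≤ 1 := by exact_mod_cast h1
      have h3 : x ^ d ≤ 1 := pow_le_one₀ hx.le hx1
      simpa using mul_le_one₀ h2 (by positivity) h3
    | succ n ih =>
      cases d with
      | zero =>
        have : (words B (n + 1)).filter (fun w => Align [] w 0) = ∅ := by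
          refine Finset.filter_eq_empty_iff.2 fun w hw h => ?_
          have := h.symm.length_le
          rw [mem_words.1 hw] at this
          simp at this
        rw [this]
        simp only [Finset.card_empty, Nat.cast_zero, zero_mul]
        positivity
      | succ d =>
        have hsub : (words B (n + 1)).filter (fun w => Align [] w (d + 1)) ⊆
            Finset.image₂ List.cons Finset.univ ((words B n).filter fun w => Align [] w d) := by
          intro w hw
          obtain ⟨hw, h⟩ := Finset.mem_filter.1 hw
          have hl := mem_words.1 hw
          cases h with
          | nil => simp at hl
          | right a h =>
            exact Finset.mem_image₂.2 ⟨a, Finset.mem_univ _, _, Finset.mem_filter.2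
              ⟨mem_words.2 (by simpa using hl), h⟩, rfl⟩
        have h1 : (((words B (n + 1)).filter fun w => Align [] w (d + 1)).card : ℝ) ≤
          (Finset.image₂ List.cons Finset.univ ((words B n).filter fun w => Align [] w d)).card := by
          exact_mod_cast Finset.card_le_card hsub
        calc _ ≤ _ := mul_le_mul_of_nonneg_right h1 (by positivity)
          _ ≤ _ := hins [] n d (ih d)
          _ ≤ ρ * ρ ^ (([] : List B).length + n) := by
              gcongr
              rw [hρ]; nlinarith
          _ = _ := by simp [pow_succ, mul_comm]
  | cons b v ihv =>
    induction n generalizing d with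
    | zero =>
      cases d with
      | zero =>
        have : (words B 0).filter (fun w => Align (b :: v) w 0) = ∅ := by
          refine Finset.filter_eq_empty_iff.2 fun w hw h => ?_
          have := h.length_le
          rw [mem_words.1 hw] at this
          simp at this
        rw [this]
        simp only [Finset.card_empty, Nat.cast_zero, zero_mul]
        positivity
      | succ d =>
        have hsub : (words B 0).filter (fun w => Align (b :: v) w (d + 1)) ⊆
            (words B 0).filter fun w => Align v w d := by
          intro w hw
          obtain ⟨hw, h⟩ := Finset.mem_filter.1 hw
          refine Finset.mem_filter.2 ⟨hw, ?_⟩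
          have hl := mem_words.1 hw
          cases h with
          | cons => simp at hl
          | left _ h => exact h
          | right => simp at hl
        have h1 : (((words B 0).filter fun w => Align (b :: v) w (d + 1)).card : ℝ) ≤
          ((words B 0).filter fun w => Align v w d).card := by
          exact_mod_cast Finset.card_le_card hsub
        calc _ ≤ _ := mul_le_mul_of_nonneg_right h1 (by positivity)
          _ = x * (((words B 0).filter fun w => Align v w d).card * x ^ d) := by ring
          _ ≤ ρ * ρ ^ (v.length + 0) := by
              have := ihv 0 d
              gcongr
              rw [hρ]; nlinarith
          _ = _ := by rw [List.length_cons, ← pow_succ']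
    | succ n ihn =>
      cases d with
      | zero =>
        have hsub : (words B (n + 1)).filter (fun w => Align (b :: v) w 0) ⊆
            ((words B n).filter fun w => Align v w 0).image (List.cons b) := by
          intro w hw
          obtain ⟨hw, h⟩ := Finset.mem_filter.1 hw
          have hl := mem_words.1 hw
          cases h with
          | cons _ h =>
            exact Finset.mem_image.2 ⟨_, Finset.mem_filter.2
              ⟨mem_words.2 (by simpa using hl), h⟩, rfl⟩
        have h1 : (((words B (n + 1)).filter fun w => Align (b :: v) w 0).card : ℝ) ≤
          ((words B n).filter fun w => Align v w 0).card := by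
          exact_mod_cast (Finset.card_le_card hsub).trans Finset.card_image_le
        calc _ ≤ _ := mul_le_mul_of_nonneg_right h1 (by positivity)
          _ ≤ _ := ihv n 0
          _ ≤ _ := pow_le_pow_right₀ hρ1 (by simp; omega)
      | succ d =>
        have hsub : (words B (n + 1)).filter (fun w => Align (b :: v) w (d + 1)) ⊆
            ((words B n).filter fun w => Align v w (d + 1)).image (List.cons b) ∪
            ((words B (n + 1)).filter fun w => Align v w d) ∪
            Finset.image₂ List.cons Finset.univ
              ((words B n).filter fun w => Align (b :: v) w d) := by
          intro w hw
          obtain ⟨hw, h⟩ := Finset.mem_filter.1 hw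
          have hl := mem_words.1 hw
          cases h with
          | cons _ h =>
            refine Finset.mem_union_left _ (Finset.mem_union_left _ ?_)
            exact Finset.mem_image.2 ⟨_, Finset.mem_filter.2
              ⟨mem_words.2 (by simpa using hl), h⟩, rfl⟩
          | left _ h =>
            exact Finset.mem_union_left _ (Finset.mem_union_right _ (Finset.mem_filter.2 ⟨hw, h⟩))
          | right a h =>
            refine Finset.mem_union_right _ ?_
            exact Finset.mem_image₂.2 ⟨a, Finset.mem_univ _, _, Finset.mem_filter.2
              ⟨mem_words.2 (by simpa using hl), h⟩, rfl⟩
        have h1 : (((words B (n + 1)).filter fun w => Align (b :: v) w (d + 1)).card : ℝ) ≤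
            ((words B n).filter fun w => Align v w (d + 1)).card +
            ((words B (n + 1)).filter fun w => Align v w d).card +
            (Finset.image₂ List.cons Finset.univ
              ((words B n).filter fun w => Align (b :: v) w d)).card := by
          have := (Finset.card_le_card hsub).trans ((Finset.card_union_le _ _).trans
            (Nat.add_le_add_right ((Finset.card_union_le _ _).trans
              (Nat.add_le_add_right Finset.card_image_le _)) _))
          exact_mod_cast this
        have e1 := ihv n (d + 1)
        have e2 := ihv (n + 1) d
        have e3 := hins (b :: v) n d (ihn d)
        have e2' := mul_le_mul_of_nonneg_left e2 hx.le
        calc _ ≤ _ := mul_le_mul_of_nonneg_right h1 (by positivity)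
          _ ≤ ρ ^ (v.length + n) + x * ρ ^ (v.length + (n + 1)) +
              Fintype.card B * x * ρ ^ ((b :: v).length + n) := by
            rw [add_mul, add_mul]
            refine add_le_add (add_le_add e1 ?_) e3
            calc _ = _ := by ring
              _ ≤ _ := e2'
          _ = ρ ^ (v.length + n) * (1 + (Fintype.card B + 1) * x * ρ) := by
            rw [List.length_cons, show v.length + 1 + n = v.length + n + 1 by ring,
              show v.length + (n + 1) = v.length + n + 1 by ring, pow_succ]
            ring
          _ ≤ ρ ^ (v.length + n) * (ρ * ρ) := by
            gcongr
            have : (Fintype.card B + 1) * x = ρ - 1 := by rw [hρ]; ring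
            rw [this]; nlinarith
          _ = _ := by rw [List.length_cons]; ring

end Alignment

section LocalFunctions

variable {B : Type}

@[simp] theorem length_prefixWord (x : ℕ → B) (n : ℕ) : (prefixWord x n).length = n := by
  simp [prefixWord]

theorem getElem_prefixWord (x : ℕ → B) (n i : ℕ) (h : i < (prefixWord x n).length) :
    (prefixWord x n)[i] = x i := by
  simp [prefixWord]

theorem prefixWord_eq_iff {x y : ℕ → B} {n : ℕ} :
    prefixWord x n = prefixWord y n ↔ ∀ i < n, x i = y i := by
  constructor
  · intro h i hi
    rw [← getElem_prefixWord x n i (by simpa using hi),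
      ← getElem_prefixWord y n i (by simpa using hi)]
    simp only [h]
  · intro h
    refine List.ext_getElem (by simp) fun i h1 h2 => ?_
    rw [getElem_prefixWord, getElem_prefixWord]
    exact h i (by simpa using h1)

theorem take_prefixWord (x : ℕ → B) {m n : ℕ} (h : m ≤ n) :
    (prefixWord x n).take m = prefixWord x m := by
  refine List.ext_getElem (by simp [h]) fun i h1 h2 => ?_
  rw [List.getElem_take, getElem_prefixWord, getElem_prefixWord]

theorem prefixWord_succ (x : ℕ → B) (n : ℕ) :
    prefixWord x (n + 1) = x 0 :: prefixWord (fun i => x (i + 1)) n := by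
  simp [prefixWord, List.ofFn_succ]

theorem prefixWord_add (x : ℕ → B) (m n : ℕ) :
    prefixWord x (m + n) = prefixWord x m ++ prefixWord (fun i => x (m + i)) n := by
  refine List.ext_getElem (by simp) fun i h1 h2 => ?_
  rw [getElem_prefixWord, List.getElem_append]
  split_ifs with h
  · rw [getElem_prefixWord]
  · rw [getElem_prefixWord]
    simp only [length_prefixWord] at h ⊢
    congr 1; omega

theorem mem_cylinder_iff {x : ℕ → B} {w : List B} :
    x ∈ cylinder w ↔ prefixWord x w.length = w := by
  constructor
  · intro h
    refine List.ext_getElem (by simp) fun i h1 h2 => ?_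
    rw [getElem_prefixWord]
    exact h ⟨i, h2⟩
  · intro h i
    have := getElem_prefixWord x w.length i (by simp)
    rw [← this]
    simp [h]

theorem mem_cylinder_prefixWord (x : ℕ → B) (n : ℕ) : x ∈ cylinder (prefixWord x n) := by
  rw [mem_cylinder_iff]; simp

/-- A bounded function of words depending only on the first `k` letters. -/
structure LocalFn (B : Type) where
  /-- the number of letters on which the function depends -/
  k : ℕ
  /-- a bound for the function -/
  C : ℝ
  /-- the function itself -/
  toFun : List B → ℝ
  toFun_take : ∀ l, toFun (l.take k) = toFun l
  abs_toFun_le : ∀ l, |toFun l| ≤ C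

namespace LocalFn

variable (F : LocalFn B)

theorem C_nonneg : 0 ≤ F.C := (abs_nonneg _).trans (F.abs_toFun_le [])

theorem toFun_congr {l l' : List B} (h : l.take F.k = l'.take F.k) : F.toFun l = F.toFun l' := by
  rw [← F.toFun_take l, h, F.toFun_take]

theorem abs_toFun_sub_le (l l' : List B) : |F.toFun l - F.toFun l'| ≤ 2 * F.C := by
  have h1 := abs_le.1 (F.abs_toFun_le l)
  have h2 := abs_le.1 (F.abs_toFun_le l')
  rw [abs_le]; constructor <;> linarith

/-- The function on sequences induced by a local function. -/
def ev (x : ℕ → B) : ℝ := F.toFun (prefixWord x F.k)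

theorem ev_eq (x : ℕ → B) {n : ℕ} (h : F.k ≤ n) : F.toFun (prefixWord x n) = F.ev x := by
  unfold ev
  apply F.toFun_congr
  rw [take_prefixWord x h, take_prefixWord x le_rfl]

/-- The sum of a local function over all nonempty suffixes of a word. -/
def bsum : List B → ℝ
  | [] => 0
  | a :: w => F.toFun (a :: w) + bsum w

theorem abs_bsum_le (w : List B) : |F.bsum w| ≤ F.C * w.length := by
  induction w with
  | nil => simp [bsum]
  | cons a w ih =>
    rw [bsum, List.length_cons]
    push_cast
    have := F.abs_toFun_le (a :: w)
    linarith [abs_add_le (F.toFun (a :: w)) (F.bsum w)]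

theorem abs_bsum_append_sub_le (u v : List B) :
    |F.bsum (u ++ v) - F.bsum u - F.bsum v| ≤ 2 * F.C * F.k := by
  have hC := F.C_nonneg
  have key : |F.bsum (u ++ v) - F.bsum u - F.bsum v| ≤ 2 * F.C * (min u.length F.k : ℕ) := by
    induction u with
    | nil => simp [bsum]
    | cons a u ih =>
      rw [List.cons_append, bsum, bsum]
      have e : F.toFun (a :: (u ++ v)) + F.bsum (u ++ v) - (F.toFun (a :: u) + F.bsum u) - F.bsum v =
        (F.toFun (a :: (u ++ v)) - F.toFun (a :: u)) +
          (F.bsum (u ++ v) - F.bsum u - F.bsum v) := by ring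
      rw [e]
      refine (abs_add_le _ _).trans ?_
      by_cases h : F.k ≤ u.length + 1
      · have : F.toFun (a :: (u ++ v)) = F.toFun (a :: u) := by
          apply F.toFun_congr
          rw [← List.cons_append, List.take_append_of_le_length (by simpa using h)]
        rw [this, sub_self, abs_zero, zero_add]
        refine ih.trans ?_
        gcongr
        simp
      · have h1 := F.abs_toFun_sub_le (a :: (u ++ v)) (a :: u)
        rw [List.length_cons, min_eq_left (by omega)]
        rw [min_eq_left (by omega)] at ih
        push_cast
        linarith
  refine key.trans ?_
  gcongr
  exact min_le_right _ _

theorem abs_bsum_insert_le (u v : List B) (a : B) :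
    |F.bsum (u ++ a :: v) - F.bsum (u ++ v)| ≤ F.C * (4 * F.k + 1) := by
  have h1 := abs_le.1 (F.abs_bsum_append_sub_le u (a :: v))
  have h2 := abs_le.1 (F.abs_bsum_append_sub_le u v)
  have h3 := abs_le.1 (F.abs_toFun_le (a :: v))
  rw [bsum] at h1
  rw [abs_le]; constructor <;> nlinarith

theorem abs_bsum_sub_le_of_align {v w : List B} {d : ℕ} (h : Align v w d) :
    |F.bsum v - F.bsum w| ≤ F.C * (4 * F.k + 1) * d := by
  have hC := F.C_nonneg
  have key : ∀ u : List B, |F.bsum (u ++ v) - F.bsum (u ++ w)| ≤ F.C * (4 * F.k + 1) * d := by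
    induction h with
    | nil d => intro u; simp; positivity
    | cons a _ ih => intro u; simpa using ih (u ++ [a])
    | @left a v w d _ ih =>
      intro u
      have h1 := F.abs_bsum_insert_le u v a
      have h2 := ih u
      push_cast
      have := abs_sub_le (F.bsum (u ++ a :: v)) (F.bsum (u ++ v)) (F.bsum (u ++ w))
      linarith
    | @right a v w d _ ih =>
      intro u
      have h1 := F.abs_bsum_insert_le u w a
      have h2 := ih u
      push_cast
      have := abs_sub_le (F.bsum (u ++ v)) (F.bsum (u ++ w)) (F.bsum (u ++ a :: w))
      rw [abs_sub_comm] at h1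
      linarith
  simpa using key []

theorem abs_sum_ev_sub_bsum_le (x : ℕ → B) (n : ℕ) :
    |∑ i ∈ Finset.range n, F.ev (shift^[i] x) - F.bsum (prefixWord x n)| ≤ 2 * F.C * F.k := by
  have hC := F.C_nonneg
  have key : |∑ i ∈ Finset.range n, F.ev (shift^[i] x) - F.bsum (prefixWord x n)| ≤
      2 * F.C * (min n F.k : ℕ) := by
    induction n generalizing x with
    | zero => simp [prefixWord, bsum]
    | succ n ih =>
      have hp := prefixWord_succ x n
      rw [Finset.sum_range_succ', hp, bsum, ← hp]
      simp only [Function.iterate_succ_apply, Function.iterate_zero, id]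
      have e : ∑ i ∈ Finset.range n, F.ev (shift^[i] (shift x)) + F.ev x -
          (F.toFun (prefixWord x (n + 1)) + F.bsum (prefixWord (fun i => x (i + 1)) n)) =
          (F.ev x - F.toFun (prefixWord x (n + 1))) +
          (∑ i ∈ Finset.range n, F.ev (shift^[i] (shift x)) -
            F.bsum (prefixWord (shift x) n)) := by
        unfold shift; ring
      rw [e]
      refine (abs_add_le _ _).trans ?_
      by_cases h : F.k ≤ n + 1
      · rw [F.ev_eq x h, sub_self, abs_zero, zero_add]
        refine (ih (shift x)).trans ?_
        gcongr
        simp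
      · have h1 := F.abs_toFun_sub_le (prefixWord x F.k) (prefixWord x (n + 1))
        have h2 := ih (shift x)
        rw [min_eq_left (by omega)] at h2 ⊢
        push_cast
        have : F.ev x = F.toFun (prefixWord x F.k) := rfl
        rw [this]
        linarith
  refine key.trans ?_
  gcongr
  exact min_le_right _ _

/-- The local function testing whether a word starts with `u`. -/
noncomputable def ind (u : List B) : LocalFn B where
  k := u.length
  C := 1
  toFun l := if u <+: l then 1 else 0
  toFun_take l := by simp [List.prefix_take_iff]
  abs_toFun_le l := by split_ifs <;> simp

/-- The local function with prescribed values on words of length `k`. -/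
noncomputable def ofValues [Fintype B] (k : ℕ) (c : List B → ℝ) : LocalFn B where
  k := k
  C := ∑ u ∈ words B k, |c u|
  toFun l := ∑ u ∈ words B k, c u * (ind u).toFun l
  toFun_take l := by
    refine Finset.sum_congr rfl fun u hu => ?_
    rw [← mem_words.1 hu]
    exact congrArg _ ((ind u).toFun_take l)
  abs_toFun_le l := by
    refine (Finset.abs_sum_le_sum_abs _ _).trans (Finset.sum_le_sum fun u _ => ?_)
    rw [abs_mul]
    exact mul_le_of_le_one_right (abs_nonneg _) ((ind u).abs_toFun_le l)

theorem ofValues_ev [Fintype B] (k : ℕ) (c : List B → ℝ) (x : ℕ → B) :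
    (ofValues k c).ev x = c (prefixWord x k) := by
  have hw : prefixWord x k ∈ words B k := mem_words.2 (by simp)
  have : (ofValues k c).ev x = ∑ u ∈ words B k, c u * (ind u).toFun (prefixWord x k) := rfl
  rw [this, Finset.sum_eq_single_of_mem _ hw]
  · simp [ind]
  · intro u hu hne
    have : ¬ u <+: prefixWord x k := fun h =>
      hne (h.eq_of_length (by rw [mem_words.1 hu]; simp))
    simp [ind, this]

theorem ofValues_ev_eq_sum [Fintype B] (k : ℕ) (c : List B → ℝ) (x : ℕ → B) :
    (ofValues k c).ev x = ∑ u ∈ words B k, c u * (ind u).ev x := by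
  have : (ofValues k c).ev x = ∑ u ∈ words B k, c u * (ind u).toFun (prefixWord x k) := rfl
  rw [this]
  refine Finset.sum_congr rfl fun u hu => ?_
  rw [(ind u).ev_eq x (mem_words.1 hu).le]

end LocalFn

theorem val_subShift {X : Set (ℕ → B)} (hX : Set.MapsTo shift X X) (x : ↥X) :
    (subShift X x).val = shift x.val := by
  simp [subShift, hX x.2]

theorem val_iterate_subShift {X : Set (ℕ → B)} (hX : Set.MapsTo shift X X) (x : ↥X) (n : ℕ) :
    ((subShift X)^[n] x).val = shift^[n] x.val := by
  induction n with
  | zero => rfl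
  | succ n ih =>
    rw [Function.iterate_succ_apply', Function.iterate_succ_apply', val_subShift hX, ih]

theorem iterate_shift_apply (x : ℕ → B) (n i : ℕ) : shift^[n] x i = x (n + i) := by
  induction n generalizing x with
  | zero => simp
  | succ n ih => rw [Function.iterate_succ_apply, ih]; simp [shift]; congr 1; omega

theorem abs_birkhoff_sub_bsum_le {X : Set (ℕ → B)} (hX : Set.MapsTo shift X X) (F : LocalFn B)
    (x : ↥X) (n : ℕ) :
    |birkhoff (subShift X) (fun y => F.ev y.val) n x - F.bsum (prefixWord x.val n)| ≤
      2 * F.C * F.k := by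
  have := F.abs_sum_ev_sub_bsum_le x.val n
  unfold birkhoff
  simpa only [val_iterate_subShift hX] using this

end LocalFunctions

section Approximation

variable {B : Type} [Fintype B] [TopologicalSpace B] [DiscreteTopology B]

theorem exists_uniform_prefix {X : Set (ℕ → B)} (hX : IsClosed X) {φ : ↥X → ℝ}
    (hφ : Continuous φ) {ε : ℝ} (hε : 0 < ε) :
    ∃ k, ∀ x y : ↥X, prefixWord x.val k = prefixWord y.val k → |φ x - φ y| ≤ ε := by
  have : CompactSpace ↥X := isCompact_iff_compactSpace.1 hX.isCompact
  have hloc : ∀ x : ↥X, ∃ k, ∀ y : ↥X, prefixWord y.val k = prefixWord x.val k →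
      |φ y - φ x| < ε / 2 := by
    intro x
    have h1 : φ ⁻¹' Metric.ball (φ x) (ε / 2) ∈ 𝓝 x :=
      hφ.continuousAt (Metric.ball_mem_nhds _ (by positivity))
    rw [nhds_subtype, Filter.mem_comap] at h1
    obtain ⟨t, ht, hts⟩ := h1
    obtain ⟨s, hs, hxs, hst⟩ :=
      (PiNat.isTopologicalBasis_cylinders (fun _ : ℕ => B)).mem_nhds_iff.1 ht
    obtain ⟨z, n, rfl⟩ := hs
    refine ⟨n, fun y hy => ?_⟩
    have : y.val ∈ PiNat.cylinder z n := by
      rw [PiNat.mem_cylinder_iff] at hxs ⊢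
      intro i hi
      rw [prefixWord_eq_iff.1 hy i hi, hxs i hi]
    have := hts (show y ∈ Subtype.val ⁻¹' t from hst this)
    simpa [Real.dist_eq] using this
  choose k hk using hloc
  let U : ↥X → Set ↥X := fun x => Subtype.val ⁻¹' PiNat.cylinder x.val (k x)
  have hU : ∀ x, IsOpen (U x) := fun x =>
    (PiNat.isOpen_cylinder (fun _ : ℕ => B) _ _).preimage continuous_subtype_val
  obtain ⟨t, ht⟩ := isCompact_univ.elim_finite_subcover U hU fun x _ =>
    mem_iUnion.2 ⟨x, PiNat.self_mem_cylinder _ _⟩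
  refine ⟨t.sup k, fun x y hxy => ?_⟩
  obtain ⟨z, hz, hxz⟩ := mem_iUnion₂.1 (ht (mem_univ x))
  have hkz : k z ≤ t.sup k := Finset.le_sup hz
  have h1 : prefixWord x.val (k z) = prefixWord z.val (k z) :=
    prefixWord_eq_iff.2 (PiNat.mem_cylinder_iff.1 hxz)
  have h2 : prefixWord y.val (k z) = prefixWord z.val (k z) := by
    rw [← h1]
    exact prefixWord_eq_iff.2 fun i hi => (prefixWord_eq_iff.1 hxy i (by omega)).symm
  have e1 := abs_lt.1 (hk z x h1)
  have e2 := abs_lt.1 (hk z y h2)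
  rw [abs_le]; constructor <;> linarith

theorem exists_localFn_approx {X : Set (ℕ → B)} (hX : IsClosed X) {φ : ↥X → ℝ}
    (hφ : Continuous φ) {ε : ℝ} (hε : 0 < ε) :
    ∃ (k : ℕ) (c : List B → ℝ), ∀ x : ↥X, |φ x - (LocalFn.ofValues k c).ev x.val| ≤ ε := by
  obtain ⟨k, hk⟩ := exists_uniform_prefix hX hφ hε
  refine ⟨k, fun u => if h : ∃ x : ↥X, prefixWord x.val k = u then φ h.choose else 0, fun x => ?_⟩
  rw [LocalFn.ofValues_ev]
  have h : ∃ y : ↥X, prefixWord y.val k = prefixWord x.val k := ⟨x, rfl⟩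
  rw [dif_pos h]
  exact hk _ _ h.choose_spec.symm

end Approximation

section Continuity

variable {B : Type} [TopologicalSpace B]

theorem continuous_of_prefixWord [DiscreteTopology B] {X : Set (ℕ → B)} {Y : Type*}
    [TopologicalSpace Y] (k : ℕ)
    (g : List B → Y) : Continuous fun x : ↥X => g (prefixWord x.val k) := by
  have h1 : Continuous fun x : ↥X => fun i : Fin k => x.val i :=
    continuous_pi fun i => (continuous_apply _).comp continuous_subtype_val
  exact (continuous_of_discreteTopology (f := fun f : Fin k → B => g (List.ofFn f))).comp h1

theorem LocalFn.continuous_ev [DiscreteTopology B] {X : Set (ℕ → B)} (F : LocalFn B) :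
    Continuous fun x : ↥X => F.ev x.val :=
  continuous_of_prefixWord F.k F.toFun

theorem continuous_subShift {X : Set (ℕ → B)} (hX : Set.MapsTo shift X X) :
    Continuous (subShift X) := by
  rw [continuous_induced_rng]
  have : (Subtype.val ∘ subShift X) = fun x : ↥X => shift x.val := by
    funext x; exact val_subShift hX x
  rw [this]
  exact continuous_pi fun i => (continuous_apply _).comp continuous_subtype_val

end Continuity

section BlockSums

variable {B : Type}

theorem sum_words_add [Fintype B] {M : Type*} [AddCommMonoid M] (m n : ℕ) (f : List B → M) :
    ∑ w ∈ words B (m + n), f w = ∑ u ∈ words B m, ∑ v ∈ words B n, f (u ++ v) := by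
  rw [← Finset.sum_product']
  symm
  refine Finset.sum_bij' (fun p _ => p.1 ++ p.2) (fun w _ => (w.take m, w.drop m)) ?_ ?_ ?_ ?_ ?_
  · intro p hp
    obtain ⟨h1, h2⟩ := Finset.mem_product.1 hp
    rw [mem_words] at h1 h2 ⊢
    simp [h1, h2]
  · intro w hw
    rw [mem_words] at hw
    simp [Finset.mem_product, mem_words, hw]
  · rintro ⟨u, v⟩ hp
    have h1 := mem_words.1 (Finset.mem_product.1 hp).1
    simp only at h1
    subst h1
    simp
  · intro w _; simp
  · intros; rfl

theorem card_words [Fintype B] (n : ℕ) : (words B n).card = Fintype.card B ^ n := by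
  simp [words]

/-- The product of the values of `q` over the first `m` consecutive blocks of length `N`. -/
def blockProd (q : List B → ℝ) (N : ℕ) : ℕ → List B → ℝ
  | 0, _ => 1
  | m + 1, l => q (l.take N) * blockProd q N m (l.drop N)

theorem sum_blockProd_le [Fintype B] {q : List B → ℝ} {N : ℕ} (hq : ∀ l, 0 ≤ q l)
    (hsum : ∑ u ∈ words B N, q u ≤ 1) (m r : ℕ) :
    ∑ w ∈ words B (m * N + r), blockProd q N m w ≤ (Fintype.card B : ℝ) ^ r := by
  have hpos : ∀ m l, 0 ≤ blockProd q N m l := by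
    intro m
    induction m with
    | zero => intro l; simp [blockProd]
    | succ m ih => intro l; exact mul_nonneg (hq _) (ih _)
  induction m with
  | zero => simp [blockProd, card_words]
  | succ m ih =>
    rw [show (m + 1) * N + r = N + (m * N + r) by ring, sum_words_add]
    have : ∀ u ∈ words B N, ∑ v ∈ words B (m * N + r), blockProd q N (m + 1) (u ++ v) =
        q u * ∑ v ∈ words B (m * N + r), blockProd q N m v := by
      intro u hu
      have hl := mem_words.1 hu
      subst hl
      rw [Finset.mul_sum]
      refine Finset.sum_congr rfl fun v _ => ?_
      simp [blockProd]
    rw [Finset.sum_congr rfl this, ← Finset.sum_mul]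
    exact (mul_le_of_le_one_left (Finset.sum_nonneg fun _ _ => hpos _ _) hsum).trans ih

theorem prod_eq_blockProd (q : List B → ℝ) (N m n : ℕ) (x : ℕ → B) (h : m * N ≤ n) :
    ∏ i ∈ Finset.range m, q (prefixWord (shift^[i * N] x) N) =
      blockProd q N m (prefixWord x n) := by
  induction m generalizing x n with
  | zero => simp [blockProd]
  | succ m ih =>
    rw [add_mul, one_mul] at h
    rw [Finset.prod_range_succ', blockProd, take_prefixWord x (by omega), mul_comm]
    simp only [zero_mul, Function.iterate_zero, id]
    congr 1
    obtain ⟨n, rfl⟩ : ∃ n', n = N + n' := ⟨n - N, by omega⟩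
    have hd : (prefixWord x (N + n)).drop N = prefixWord (shift^[N] x) n := by
      rw [prefixWord_add, List.drop_append_of_le_length (by simp)]
      have : (fun i => x (N + i)) = shift^[N] x := by
        funext i; rw [iterate_shift_apply]
      rw [this, List.drop_of_length_le (by simp), List.nil_append]
    rw [hd, ← ih n (shift^[N] x) (by omega)]
    refine Finset.prod_congr rfl fun i _ => ?_
    rw [← Function.iterate_add_apply]
    congr 3; ring

theorem drop_prefixWord (x : ℕ → B) (j n : ℕ) :
    (prefixWord x (j + n)).drop j = prefixWord (shift^[j] x) n := by
  rw [prefixWord_add, List.drop_append_of_le_length (by simp)]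
  have : (fun i => x (j + i)) = shift^[j] x := by
    funext i; rw [iterate_shift_apply]
  rw [this, List.drop_of_length_le (by simp), List.nil_append]

theorem sum_range_mul_eq (f : ℕ → ℝ) (m N : ℕ) :
    ∑ i ∈ Finset.range (m * N), f i =
      ∑ j ∈ Finset.range N, ∑ i ∈ Finset.range m, f (j + i * N) := by
  induction m with
  | zero => simp
  | succ m ih =>
    rw [add_mul, one_mul, Finset.sum_range_add, ih, ← Finset.sum_add_distrib]
    refine Finset.sum_congr rfl fun j _ => ?_
    rw [Finset.sum_range_succ, add_comm j]

theorem exp_sum_log_le {q : List B → ℝ} {N : ℕ} (hN : 0 < N) (hq : ∀ l, 0 < q l) (m n : ℕ)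
    (hn : m * N + N ≤ n) (x : ℕ → B) :
    Real.exp (∑ i ∈ Finset.range (m * N), Real.log (q (prefixWord (shift^[i] x) N)) / N) ≤
      ∑ j ∈ Finset.range N, blockProd q N m ((prefixWord x n).drop j) := by
  have hN' : (0 : ℝ) < N := by exact_mod_cast hN
  have hb : ∀ j ∈ Finset.range N, blockProd q N m ((prefixWord x n).drop j) =
      Real.exp (∑ i ∈ Finset.range m, Real.log (q (prefixWord (shift^[j + i * N] x) N))) := by
    intro j hj
    have hj := Finset.mem_range.1 hj
    obtain ⟨n', rfl⟩ : ∃ n', n = j + n' := ⟨n - j, by omega⟩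
    rw [drop_prefixWord, ← prod_eq_blockProd q N m n' _ (by omega), Real.exp_sum]
    refine Finset.prod_congr rfl fun i _ => ?_
    rw [Real.exp_log (hq _), ← Function.iterate_add_apply, add_comm]
  rw [Finset.sum_congr rfl hb]
  obtain ⟨j, hj, hle⟩ : ∃ j ∈ Finset.range N,
      ∑ i ∈ Finset.range (m * N), Real.log (q (prefixWord (shift^[i] x) N)) / N ≤
        ∑ i ∈ Finset.range m, Real.log (q (prefixWord (shift^[j + i * N] x) N)) := by
    apply Finset.exists_le_of_sum_le ⟨0, Finset.mem_range.2 hN⟩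
    rw [Finset.sum_const, Finset.card_range, nsmul_eq_mul, ← sum_range_mul_eq
      (fun i => Real.log (q (prefixWord (shift^[i] x) N))), ← Finset.sum_div]
    field_simp
    exact le_rfl
  exact (Real.exp_le_exp.2 hle).trans (Finset.single_le_sum
    (f := fun j => Real.exp (∑ i ∈ Finset.range m,
      Real.log (q (prefixWord (shift^[j + i * N] x) N)))) (fun _ _ => (Real.exp_pos _).le) hj)

theorem sum_exp_sum_log_le [Fintype B] {q : List B → ℝ} {N : ℕ} (hN : 0 < N) (hq : ∀ l, 0 < q l)
    (hq1 : ∀ l, q l ≤ 1) (hsum : ∑ u ∈ words B N, q u ≤ 1) {n : ℕ} (hn : N ≤ n)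
    (S : Finset (List B)) (hS : S ⊆ words B n) (x : List B → ℕ → B)
    (hx : ∀ w ∈ S, prefixWord (x w) n = w) :
    ∑ w ∈ S, Real.exp (∑ i ∈ Finset.range n,
        Real.log (q (prefixWord (shift^[i] (x w)) N)) / N) ≤
      N * ((Fintype.card B : ℝ) + 1) ^ (2 * N) := by
  obtain ⟨m, r, hr, hn', hNr⟩ : ∃ m r, r < 2 * N ∧ n = m * N + N + (r - N) ∧ N ≤ r := by
    refine ⟨n / N - 1, n % N + N, by have := Nat.mod_lt n hN; omega, ?_, by omega⟩
    have h1 := Nat.div_add_mod n N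
    have h2 : 1 ≤ n / N := (Nat.one_le_div_iff hN).2 hn
    obtain ⟨c, hc⟩ : ∃ c, n / N = c + 1 := ⟨n / N - 1, by omega⟩
    rw [hc] at h1 ⊢
    simp only [Nat.add_sub_cancel]
    rw [mul_add, mul_one, mul_comm] at h1
    omega
  have hpos : ∀ m l, 0 ≤ blockProd q N m l := by
    intro m
    induction m with
    | zero => intro l; simp [blockProd]
    | succ m ih => intro l; exact mul_nonneg (hq _).le (ih _)
  calc _ ≤ ∑ w ∈ S, ∑ j ∈ Finset.range N, blockProd q N m (w.drop j) := by
        refine Finset.sum_le_sum fun w hw => ?_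
        refine le_trans ?_ ((exp_sum_log_le hN hq m n (by omega) (x w)).trans_eq ?_)
        · rw [Real.exp_le_exp]
          rw [← neg_le_neg_iff, ← Finset.sum_neg_distrib, ← Finset.sum_neg_distrib]
          refine Finset.sum_le_sum_of_subset_of_nonneg (Finset.range_mono (by omega)) ?_
          intro i _ _
          exact neg_nonneg.2 (div_nonpos_of_nonpos_of_nonneg (Real.log_nonpos (hq _).le (hq1 _))
              (Nat.cast_nonneg _))
        · rw [hx w hw]
    _ ≤ ∑ w ∈ words B n, ∑ j ∈ Finset.range N, blockProd q N m (w.drop j) :=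
        Finset.sum_le_sum_of_subset_of_nonneg hS fun w _ _ =>
          Finset.sum_nonneg fun j _ => hpos _ _
    _ = ∑ j ∈ Finset.range N, ∑ w ∈ words B n, blockProd q N m (w.drop j) := Finset.sum_comm
    _ ≤ ∑ j ∈ Finset.range N, ((Fintype.card B : ℝ) + 1) ^ (2 * N) := by
        refine Finset.sum_le_sum fun j hj => ?_
        have hj := Finset.mem_range.1 hj
        rw [show n = j + (m * N + (r - j)) by omega, sum_words_add]
        have : ∀ u ∈ words B j, ∑ v ∈ words B (m * N + (r - j)),
            blockProd q N m ((u ++ v).drop j) ≤ (Fintype.card B : ℝ) ^ (r - j) := by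
          intro u hu
          have hl := mem_words.1 hu
          subst hl
          simpa using sum_blockProd_le (fun l => (hq l).le) hsum m (r - u.length)
        refine (Finset.sum_le_sum this).trans ?_
        rw [Finset.sum_const, card_words, nsmul_eq_mul]
        push_cast
        rw [← pow_add]
        calc _ ≤ ((Fintype.card B : ℝ) + 1) ^ (j + (r - j)) := by gcongr; linarith
          _ ≤ _ := pow_le_pow_right₀ (by linarith [Nat.cast_nonneg (α := ℝ) (Fintype.card B)])
            (by omega)
    _ = _ := by simp

end BlockSums

section PrefixMeasures

set_option linter.unusedSectionVars false

variable {B : Type} [Fintype B] [TopologicalSpace B] [DiscreteTopology B] [MeasurableSpace B]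
  [BorelSpace B] {X : Set (ℕ → B)}

theorem measurableSet_cylinder (u : List B) : MeasurableSet (cylinder u) := by
  have : cylinder u = ⋂ i : Fin u.length, (fun x : ℕ → B => x i) ⁻¹' {u.get i} := by
    ext x; simp [cylinder]
  rw [this]
  exact MeasurableSet.iInter fun i =>
    (isClosed_discrete _).measurableSet.preimage (measurable_pi_apply _)

/-- The measure of the cylinder of a word. -/
noncomputable def cylMass (μ : Measure ↥X) (u : List B) : ℝ :=
  μ.real (Subtype.val ⁻¹' cylinder u)

theorem integral_prefixWord (μ : Measure ↥X) [IsProbabilityMeasure μ] (n : ℕ) (c : List B → ℝ) :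
    ∫ x, c (prefixWord x.val n) ∂μ = ∑ u ∈ words B n, cylMass μ u * c u := by
  have hm : ∀ u : List B, MeasurableSet (Subtype.val ⁻¹' cylinder u : Set ↥X) := fun u =>
    measurable_subtype_coe (measurableSet_cylinder u)
  have h : (fun x : ↥X => c (prefixWord x.val n)) = fun x => ∑ u ∈ words B n,
      (Subtype.val ⁻¹' cylinder u : Set ↥X).indicator (fun _ => c u) x := by
    funext x
    rw [Finset.sum_eq_single_of_mem (prefixWord x.val n) (mem_words.2 (by simp))]
    · rw [indicator_of_mem]
      exact mem_cylinder_prefixWord _ _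
    · intro u hu hne
      rw [indicator_of_notMem]
      intro hx
      have := mem_cylinder_iff.1 hx
      rw [mem_words.1 hu] at this
      exact hne this.symm
  rw [h, integral_finsetSum _ fun u _ => (integrable_const _).indicator (hm u)]
  refine Finset.sum_congr rfl fun u _ => ?_
  rw [integral_indicator_const _ (hm u)]
  rfl

theorem sum_cylMass (μ : Measure ↥X) [IsProbabilityMeasure μ] (n : ℕ) :
    ∑ u ∈ words B n, cylMass μ u = 1 := by
  have := integral_prefixWord μ n fun _ => 1
  simpa using this.symm

theorem wordEntropy_eq_sum [DecidableEq B] (μ : ProbabilityMeasure ↥X) (n : ℕ) :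
    wordEntropy X μ n = ∑ u ∈ words B n, Real.negMulLog (cylMass μ.toMeasure u) := by
  unfold wordEntropy words
  rw [Finset.sum_map]
  refine Finset.sum_congr (by congr) fun w _ => ?_
  have : cylinder ((⟨List.ofFn, List.ofFn_injective⟩ : (Fin n → B) ↪ List B) w) = cylF w := by
    change cylinder (List.ofFn w) = cylF w
    ext x
    rw [mem_cylinder_iff]
    simp only [List.length_ofFn, prefixWord, cylF, mem_ofPred_eq, List.ofFn_inj, funext_iff]
    exact ⟨fun h i => h (Fin.cast (by simp) i), fun h i => h _⟩
  rw [cylMass, this]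
  rfl

theorem cylMass_nonneg (μ : Measure ↥X) (u : List B) : 0 ≤ cylMass μ u := measureReal_nonneg

theorem cylMass_le_one (μ : Measure ↥X) [IsProbabilityMeasure μ] (u : List B) :
    cylMass μ u ≤ 1 := measureReal_le_one

theorem wordEntropy_nonneg (μ : ProbabilityMeasure ↥X) (n : ℕ) : 0 ≤ wordEntropy X μ n := by
  rw [wordEntropy_eq_sum]
  exact Finset.sum_nonneg fun u _ => Real.negMulLog_nonneg (cylMass_nonneg _ _) (cylMass_le_one _ _)

theorem bddBelow_entropy (μ : ProbabilityMeasure ↥X) :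
    BddBelow (range fun n : ℕ => wordEntropy X μ (n + 1) / (n + 1)) := by
  refine ⟨0, ?_⟩
  rintro _ ⟨n, rfl⟩
  exact div_nonneg (wordEntropy_nonneg _ _) (by positivity)

theorem entropy_nonneg (μ : ProbabilityMeasure ↥X) : 0 ≤ entropy X μ :=
  le_ciInf fun _ => div_nonneg (wordEntropy_nonneg _ _) (by positivity)

/-- Mixing the cylinder masses with the uniform distribution yields a strictly positive
distribution whose logarithm almost computes the entropy. -/
theorem exists_positive_distribution (μ : ProbabilityMeasure ↥X) (N : ℕ) {ε : ℝ} (hε : 0 < ε) :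
    ∃ q : List B → ℝ, (∀ l, 0 < q l) ∧ (∀ l, q l ≤ 1) ∧ ∑ u ∈ words B N, q u ≤ 1 ∧
      -(wordEntropy X μ N + ε) ≤ ∫ x, Real.log (q (prefixWord x.val N)) ∂μ.toMeasure := by
  have hM0 : 0 < (words B N).card := by
    rw [Finset.card_pos]
    by_contra h
    have h2 := sum_cylMass μ.toMeasure N
    rw [Finset.not_nonempty_iff_eq_empty.1 h] at h2
    simp at h2
  set M : ℝ := ((words B N).card : ℝ) with hM
  have hM1 : 1 ≤ M := by rw [hM]; exact_mod_cast Nat.succ_le_of_lt hM0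
  set η := ε / M with hη
  have hη0 : 0 < η := by positivity
  have hηM : η * M = ε := by rw [hη]; field_simp
  have hq0 : ∀ l, 0 < cylMass μ.toMeasure l + η := fun l => by
    have := cylMass_nonneg μ.toMeasure l; positivity
  refine ⟨fun l => (cylMass μ.toMeasure l + η) / (1 + ε), fun l => div_pos (hq0 l) (by positivity),
    fun l => ?_, ?_, ?_⟩
  · rw [div_le_one (by positivity)]
    have := cylMass_le_one μ.toMeasure l
    have : η ≤ ε := by rw [← hηM]; nlinarith
    linarith
  · rw [← Finset.sum_div, Finset.sum_add_distrib, sum_cylMass, Finset.sum_const, nsmul_eq_mul, ← hM,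
      mul_comm, hηM, div_self (by positivity)]
  · rw [integral_prefixWord μ.toMeasure N fun l => Real.log ((cylMass μ.toMeasure l + η) / (1 + ε)),
      wordEntropy_eq_sum]
    have : ε = ∑ u ∈ words B N, cylMass μ.toMeasure u * ε := by
      rw [← Finset.sum_mul, sum_cylMass, one_mul]
    nth_rewrite 1 [this]
    rw [← Finset.sum_add_distrib, ← Finset.sum_neg_distrib]
    refine Finset.sum_le_sum fun u _ => ?_
    rcases (cylMass_nonneg μ.toMeasure u).eq_or_lt with h | h
    · rw [← h]; simp
    · rw [Real.log_div (hq0 u).ne' (by positivity), Real.negMulLog]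
      have h1 : Real.log (cylMass μ.toMeasure u) ≤ Real.log (cylMass μ.toMeasure u + η) :=
        Real.log_le_log h (by linarith)
      have h2 : Real.log (1 + ε) ≤ ε := by
        have := Real.log_le_sub_one_of_pos (show 0 < 1 + ε by positivity); linarith
      nlinarith

end PrefixMeasures

section UpperBound

set_option linter.unusedSectionVars false

variable {B : Type} [Fintype B] [TopologicalSpace B] [DiscreteTopology B] [MeasurableSpace B]
  [BorelSpace B] {X : Set (ℕ → B)}

theorem abs_birkhoff_sub_le {φ : ↥X → ℝ} (hX : Set.MapsTo shift X X) {ε b : ℝ} {k : ℕ}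
    (hε : 0 ≤ ε) (hk : ∀ x y : ↥X, prefixWord x.val k = prefixWord y.val k → |φ x - φ y| ≤ ε)
    (hb : ∀ x, |φ x| ≤ b) {x y : ↥X} {n : ℕ} (h : prefixWord x.val n = prefixWord y.val n) :
    |birkhoff (subShift X) φ n x - birkhoff (subShift X) φ n y| ≤ ε * n + 2 * b * k := by
  have hb0 : 0 ≤ b := (abs_nonneg _).trans (hb x)
  unfold birkhoff
  rw [← Finset.sum_sub_distrib]
  refine (Finset.abs_sum_le_sum_abs _ _).trans ?_
  calc _ ≤ ∑ i ∈ Finset.range n, (ε + if n < i + k then 2 * b else 0) := by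
        refine Finset.sum_le_sum fun i hi => ?_
        split_ifs with hik
        · have h1 := abs_le.1 (hb ((subShift X)^[i] x))
          have h2 := abs_le.1 (hb ((subShift X)^[i] y))
          rw [abs_le]; constructor <;> linarith
        · rw [add_zero]
          apply hk
          rw [prefixWord_eq_iff]
          intro j hj
          rw [val_iterate_subShift hX, val_iterate_subShift hX, iterate_shift_apply,
            iterate_shift_apply]
          exact prefixWord_eq_iff.1 h _ (by omega)
    _ ≤ _ := by
        rw [Finset.sum_add_distrib, Finset.sum_const, Finset.card_range, nsmul_eq_mul,
          ← Finset.sum_filter, Finset.sum_const, nsmul_eq_mul, mul_comm ε, mul_comm (2 * b)]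
        gcongr
        have : (Finset.range n).filter (fun i => n < i + k) ⊆ Finset.Ico (n - k) n := by
          intro i hi
          simp only [Finset.mem_filter, Finset.mem_range] at hi
          rw [Finset.mem_Ico]; omega
        have := Finset.card_le_card this
        rw [Nat.card_Ico] at this
        omega

theorem mcalLim_eq_zero (hXcl : IsClosed X) (hX : Set.MapsTo shift X X) {φ : ↥X → ℝ}
    (hφ : Continuous φ) (μ : ProbabilityMeasure ↥X) {Z : Set ↥X}
    (hZ : ∀ x ∈ Z, μ ∈ limitPts (subShift X) x) {t : ℝ}
    (ht : entropy X μ + ∫ x, φ x ∂μ.toMeasure < t) : McalLim X φ Z t = 0 := by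
  have : CompactSpace ↥X := isCompact_iff_compactSpace.1 hXcl.isCompact
  obtain ⟨ε, hε, htε⟩ : ∃ ε > 0, t = entropy X μ + ∫ x, φ x ∂μ.toMeasure + 8 * ε :=
    ⟨(t - (entropy X μ + ∫ x, φ x ∂μ.toMeasure)) / 8, by linarith, by ring⟩
  obtain ⟨N', hN'⟩ := exists_lt_of_ciInf_lt (show entropy X μ < entropy X μ + ε by linarith)
  obtain ⟨N, rfl⟩ : ∃ N, N = N' + 1 := ⟨_, rfl⟩
  set N := N' + 1 with hNdef
  have hN0 : (0 : ℝ) < N := by positivity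
  have hN1 : (1 : ℝ) ≤ N := by rw [hNdef]; push_cast; linarith [Nat.cast_nonneg (α := ℝ) N']
  have hH : wordEntropy X μ N < (entropy X μ + ε) * N := by
    rw [← div_lt_iff₀ hN0]; rw [hNdef]; push_cast; exact hN'
  obtain ⟨q, hq0, hq1, hqs, hqi⟩ := exists_positive_distribution μ N hε
  let ψ : C(↥X, ℝ) := ⟨fun x => Real.log (q (prefixWord x.val N)) / N,
    continuous_of_prefixWord N fun l => Real.log (q l) / N⟩
  have hψ : -(entropy X μ + 2 * ε) < ∫ x, ψ x ∂μ.toMeasure := by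
    have : ∫ x, ψ x ∂μ.toMeasure = (∫ x, Real.log (q (prefixWord x.val N)) ∂μ.toMeasure) / N :=
      integral_div _ _
    rw [this, lt_div_iff₀ hN0]
    nlinarith
  obtain ⟨k, hk⟩ := exists_uniform_prefix hXcl hφ hε
  obtain ⟨b, hb⟩ : ∃ b, ∀ x, |φ x| ≤ b := by
    obtain ⟨b, hb⟩ := isCompact_univ.exists_bound_of_continuousOn hφ.continuousOn
    exact ⟨b, fun x => by simpa using hb x (mem_univ _)⟩
  let good : ℕ → List B → ↥X → Prop := fun n w x => prefixWord x.val n = w ∧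
    -((entropy X μ + 3 * ε) * n) ≤ birkhoff (subShift X) ψ n x ∧
    birkhoff (subShift X) φ n x ≤ ((∫ x, φ x ∂μ.toMeasure) + ε) * n
  have hgood : ∀ x ∈ Z, ∀ n1 : ℕ, ∃ n ≥ n1, good n (prefixWord x.val n) x := by
    intro x hx n1
    obtain ⟨s, hs, hlim⟩ := hZ x hx
    have e1 := (hlim ψ).eventually_const_lt (show -(entropy X μ + 3 * ε) < _ by linarith)
    have e2 := (hlim ⟨φ, hφ⟩).eventually_lt_const
      (show _ < (∫ x, φ x ∂μ.toMeasure) + ε by simpa using hε)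
    obtain ⟨j, h1, h2, h3⟩ := (e1.and (e2.and (eventually_ge_atTop (n1 + 1)))).exists
    have hsj : n1 + 1 ≤ s j := h3.trans (hs.id_le j)
    have hpos : (0 : ℝ) < s j := by exact_mod_cast (by omega : 0 < s j)
    refine ⟨s j, by omega, rfl, ?_, ?_⟩
    · unfold birkAvg at h1
      rw [← div_eq_inv_mul, lt_div_iff₀ hpos] at h1
      linarith
    · unfold birkAvg at h2
      rw [← div_eq_inv_mul, div_lt_iff₀ hpos] at h2
      exact h2.le
  let S : ℕ → Finset (List B) := fun n => (words B n).filter fun w => ∃ x, good n w x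
  have hSx : ∀ n, ∀ w ∈ S n, ∃ x, good n w x := fun n w hw => (Finset.mem_filter.1 hw).2
  let x : List B → ↥X := fun w => if h : ∃ x, good w.length w x then h.choose else
    (μ.nonempty).some
  have hx : ∀ n, ∀ w ∈ S n, good n w (x w) := by
    intro n w hw
    have h1 := mem_words.1 (Finset.mem_filter.1 hw).1
    have h2 := hSx n w hw
    rw [← h1] at h2 ⊢
    simp only [x, dif_pos h2]
    exact h2.choose_spec
  set D : ℝ := Real.exp (2 * b * k) * (N * ((Fintype.card B : ℝ) + 1) ^ (2 * N)) with hD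
  have hterm : ∀ n ≥ N, ∑ w ∈ S n, Real.exp (-t * w.length +
      sSup (birkhoff (subShift X) φ w.length '' (Subtype.val ⁻¹' cylinder w))) ≤
        D * Real.exp (-3 * ε) ^ n := by
    intro n hn
    calc _ ≤ ∑ w ∈ S n, (Real.exp (2 * b * k) * Real.exp (-3 * ε) ^ n) *
          Real.exp (∑ i ∈ Finset.range n,
            Real.log (q (prefixWord (shift^[i] (x w).val) N)) / N) := by
          refine Finset.sum_le_sum fun w hw => ?_
          obtain ⟨g1, g2, g3⟩ := hx n w hw
          have hl := mem_words.1 (Finset.mem_filter.1 hw).1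
          rw [hl, ← Real.exp_nat_mul, ← Real.exp_add, ← Real.exp_add, Real.exp_le_exp]
          have hsup : sSup (birkhoff (subShift X) φ n '' (Subtype.val ⁻¹' cylinder w)) ≤
              ((∫ x, φ x ∂μ.toMeasure) + ε) * n + (ε * n + 2 * b * k) := by
            apply csSup_le
            · refine ⟨_, mem_image_of_mem _ (?_ : x w ∈ _)⟩
              rw [mem_preimage, mem_cylinder_iff, hl, g1]
            · rintro _ ⟨y, hy, rfl⟩
              rw [mem_preimage, mem_cylinder_iff, hl] at hy
              have := abs_le.1 (abs_birkhoff_sub_le hX hε.le hk hb (hy.trans g1.symm))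
              linarith
          have hψs : birkhoff (subShift X) ψ n (x w) = ∑ i ∈ Finset.range n,
              Real.log (q (prefixWord (shift^[i] (x w).val) N)) / N := by
            unfold birkhoff
            refine Finset.sum_congr rfl fun i _ => ?_
            rw [← val_iterate_subShift hX]
            rfl
          rw [← hψs, htε]
          nlinarith
      _ = (Real.exp (2 * b * k) * Real.exp (-3 * ε) ^ n) * ∑ w ∈ S n, Real.exp
          (∑ i ∈ Finset.range n, Real.log (q (prefixWord (shift^[i] (x w).val) N)) / N) := by
          rw [Finset.mul_sum]
      _ ≤ (Real.exp (2 * b * k) * Real.exp (-3 * ε) ^ n) *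
          (N * ((Fintype.card B : ℝ) + 1) ^ (2 * N)) := by
          gcongr
          exact sum_exp_sum_log_le (by omega) hq0 hq1 hqs hn (S n) (Finset.filter_subset _ _)
            (fun w => (x w).val) fun w hw => (hx n w hw).1
      _ = _ := by rw [hD]; ring
  let f : ℕ → ℝ≥0∞ := fun n => ENNReal.ofReal (D * Real.exp (-3 * ε) ^ n)
  have hf : ∑' n, f n ≠ ⊤ := by
    have : Summable fun n : ℕ => D * Real.exp (-3 * ε) ^ n :=
      (summable_geometric_of_lt_one (Real.exp_pos _).le
        (Real.exp_lt_one_iff.2 (by linarith))).mul_left D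
    exact this.tsum_ofReal_ne_top
  have htail := ENNReal.tendsto_sum_nat_add f hf
  unfold McalLim
  rw [ENNReal.iSup_eq_zero]
  intro N0
  rw [← nonpos_iff_eq_zero]
  refine ge_of_tendsto htail ?_
  filter_upwards [eventually_ge_atTop (N0 + 1 + N)] with n1 hn1
  unfold Mcal
  refine (iInf₂_le (⋃ n, (S (n + n1) : Set (List B))) (to_countable _)).trans ?_
  refine (iInf₂_le ?_ ?_).trans ?_
  · intro w hw
    obtain ⟨n, hn⟩ := mem_iUnion.1 hw
    have := mem_words.1 (Finset.mem_filter.1 (Finset.mem_coe.1 hn)).1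
    omega
  · intro y hy
    obtain ⟨n, hn, hg⟩ := hgood y hy n1
    obtain ⟨m, rfl⟩ : ∃ m, n = m + n1 := ⟨n - n1, by omega⟩
    refine mem_iUnion₂.2 ⟨prefixWord y.val (m + n1), mem_iUnion.2 ⟨m, ?_⟩,
      mem_cylinder_prefixWord _ _⟩
    exact Finset.mem_coe.2 (Finset.mem_filter.2 ⟨mem_words.2 (by simp), y, hg⟩)
  · refine (ENNReal.tsum_iUnion_le_tsum (fun w : List B => ENNReal.ofReal (Real.exp
      (-t * w.length + sSup (birkhoff (subShift X) φ w.length '' (Subtype.val ⁻¹' cylinder w)))))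
      fun n => (S (n + n1) : Set (List B))).trans ?_
    refine ENNReal.tsum_le_tsum fun n => ?_
    rw [Finset.tsum_subtype' (S (n + n1)) (fun w : List B => ENNReal.ofReal (Real.exp
      (-t * w.length + sSup (birkhoff (subShift X) φ w.length '' (Subtype.val ⁻¹' cylinder w))))),
      ← ENNReal.ofReal_sum_of_nonneg fun _ _ => (Real.exp_pos _).le]
    exact ENNReal.ofReal_le_ofReal (hterm _ (by omega))

end UpperBound

section LawOfLargeNumbers

open ProbabilityTheory

theorem eventually_half_le_sum_sub_le {Y : Type*} [MeasurableSpace Y] (ν : Measure Y)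
    [IsProbabilityMeasure ν] {ι : Type*} [Fintype ι] (f : ι → Y → ℝ)
    (hm : ∀ a, Measurable (f a)) (hi : ∀ a, Integrable (f a) ν) :
    ∀ᶠ m : ℕ in atTop, 1 / 2 ≤ (Measure.infinitePi fun _ : ℕ => ν).real
      {ω | ∀ a, |∑ i ∈ Finset.range m, f a (ω i) - m * ∫ y, f a y ∂ν| ≤ m} := by
  set P := Measure.infinitePi fun _ : ℕ => ν with hP
  have hmp : ∀ i, MeasurePreserving (fun ω : ℕ → Y => ω i) P ν := fun i =>
    measurePreserving_eval_infinitePi _ i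
  have hfi : ∀ a, ∫ ω, f a (ω 0) ∂P = ∫ y, f a y ∂ν := fun a => by
    rw [← (hmp 0).map_eq, integral_map (hmp 0).measurable.aemeasurable
      (hm a).aestronglyMeasurable]
  have hlim : ∀ᵐ ω ∂P, Tendsto (fun m : ℕ => fun a =>
      (∑ i ∈ Finset.range m, f a (ω i)) / (m : ℝ)) atTop (𝓝 fun a => ∫ y, f a y ∂ν) := by
    simp only [tendsto_pi_nhds]
    rw [ae_all_iff]
    intro a
    have hid : ∀ i, IdentDistrib (fun ω : ℕ → Y => f a (ω i)) (fun ω : ℕ → Y => f a (ω 0)) P P := by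
      intro i
      refine ⟨((hm a).comp (hmp i).measurable).aemeasurable,
        ((hm a).comp (hmp 0).measurable).aemeasurable, ?_⟩
      change Measure.map (f a ∘ fun ω => ω i) P = Measure.map (f a ∘ fun ω => ω 0) P
      rw [← Measure.map_map (hm a) (hmp i).measurable, ← Measure.map_map (hm a) (hmp 0).measurable,
        (hmp i).map_eq, (hmp 0).map_eq]
    have := strong_law_ae_real (μ := P) (fun i ω => f a (ω i))
      ((hmp 0).integrable_comp_of_integrable (hi a))
      (fun i j hij => (iIndepFun_infinitePi (P := fun _ : ℕ => ν) (X := fun _ => f a)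
        fun _ => hm a).indepFun hij) hid
    simp only [hfi] at this
    exact this
  have hmeas := tendstoInMeasure_of_tendsto_ae (fun m => (measurable_pi_lambda
    (fun ω : ℕ → Y => fun a => (∑ i ∈ Finset.range m, f a (ω i)) / (m : ℝ)) fun a =>
      (Finset.measurable_sum _ fun i _ =>
        (hm a).comp (hmp i).measurable).div_const _).aestronglyMeasurable) hlim
  have h1 := (hmeas 1 one_pos).eventually_le_const (show (0 : ℝ≥0∞) < ENNReal.ofReal (1 / 2) by
    simp)
  filter_upwards [h1, eventually_gt_atTop 0] with m h1 hm0
  have hm0' : (0 : ℝ) < m := by exact_mod_cast hm0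
  set good := {ω : ℕ → Y | ∀ a, |∑ i ∈ Finset.range m, f a (ω i) - m * ∫ y, f a y ∂ν| ≤ m}
    with hgood
  set bad := {ω : ℕ → Y | 1 ≤ edist (fun a => (∑ i ∈ Finset.range m, f a (ω i)) / (m : ℝ))
    (fun a => ∫ y, f a y ∂ν)} with hbad
  have hcov : (univ : Set (ℕ → Y)) ⊆ good ∪ bad := by
    intro ω _
    by_contra h
    rw [mem_union, not_or] at h
    apply h.1
    intro a
    have h2 : edist (fun a => (∑ i ∈ Finset.range m, f a (ω i)) / (m : ℝ))
      (fun a => ∫ y, f a y ∂ν) < 1 := not_le.1 h.2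
    have h3 := (edist_le_pi_edist (fun a => (∑ i ∈ Finset.range m, f a (ω i)) / (m : ℝ))
      (fun a => ∫ y, f a y ∂ν) a).trans_lt h2
    rw [edist_dist, ENNReal.ofReal_lt_one, Real.dist_eq] at h3
    have e : ∑ i ∈ Finset.range m, f a (ω i) - m * ∫ y, f a y ∂ν =
        m * ((∑ i ∈ Finset.range m, f a (ω i)) / (m : ℝ) - ∫ y, f a y ∂ν) := by
      field_simp
    rw [e, abs_mul, abs_of_pos hm0']
    nlinarith
  have h2 : P.real univ ≤ P.real good + P.real bad :=
    (measureReal_mono hcov).trans (measureReal_union_le _ _)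
  have h3 : P.real bad ≤ 1 / 2 := ENNReal.toReal_le_of_le_ofReal (by norm_num) h1
  rw [probReal_univ] at h2
  linarith

end LawOfLargeNumbers

section Concatenation

variable {B : Type}

/-- The concatenation `w 0 ++ w 1 ++ ⋯ ++ w (m - 1)`. -/
def cat (w : ℕ → List B) : ℕ → List B
  | 0 => []
  | m + 1 => cat w m ++ w m

theorem length_cat (w : ℕ → List B) (m : ℕ) :
    (cat w m).length = ∑ i ∈ Finset.range m, (w i).length := by
  induction m with
  | zero => rfl
  | succ m ih => rw [cat, List.length_append, ih, Finset.sum_range_succ]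

theorem eq_of_cat_eq {w v : ℕ → List B} {m : ℕ} (hl : ∀ i < m, (w i).length = (v i).length)
    (h : cat w m = cat v m) : ∀ i < m, w i = v i := by
  induction m with
  | zero => intro i hi; omega
  | succ m ih =>
    rw [cat, cat] at h
    obtain ⟨h1, h2⟩ := List.append_inj' h (hl m (by omega))
    intro i hi
    rcases Nat.lt_succ_iff_lt_or_eq.1 hi with hi | rfl
    · exact ih (fun i hi => hl i (by omega)) h1 i hi
    · exact h2

/-- `W` can be edited into a word of `G` with cost at most `D`. -/
def Near (G : Set (List B)) (W : List B) (D : ℕ) : Prop := ∃ V ∈ G, Align V W D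

theorem Near.append {G : Set (List B)} {τ : ℕ}
    (hG : ∀ v ∈ G, ∀ w ∈ G, ∃ u : List B, u.length ≤ τ ∧ v ++ u ++ w ∈ G) {W W' : List B}
    {D D' : ℕ} (h : Near G W D) (h' : Near G W' D') : Near G (W ++ W') (D + D' + τ) := by
  obtain ⟨V, hV, hA⟩ := h
  obtain ⟨V', hV', hA'⟩ := h'
  obtain ⟨u, hu, hG'⟩ := hG V hV V' hV'
  refine ⟨_, hG', ?_⟩
  exact ((hA.append_left u).append hA').mono (by omega)

theorem Near.cat {G : Set (List B)} {τ e : ℕ}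
    (hG : ∀ v ∈ G, ∀ w ∈ G, ∃ u : List B, u.length ≤ τ ∧ v ++ u ++ w ∈ G) {w : ℕ → List B}
    {m : ℕ} (hm : 0 < m) (h : ∀ i < m, Near G (w i) e) :
    ∃ D, Near G (cat w m) D ∧ D + τ ≤ m * (e + τ) := by
  induction m with
  | zero => omega
  | succ m ih =>
    rcases Nat.eq_zero_or_pos m with rfl | hm'
    · refine ⟨e, ?_, by omega⟩
      simpa [Paper.cat] using h 0 (by omega)
    · obtain ⟨D, hD, hDτ⟩ := ih hm' fun i hi => h i (by omega)
      refine ⟨D + e + τ, hD.append hG (h m (by omega)), ?_⟩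
      rw [add_mul]; omega

theorem LocalFn.abs_bsum_append_cat_le (F : LocalFn B) (u : List B) (w : ℕ → List B) (m : ℕ) :
    |F.bsum (u ++ cat w m) - F.bsum u - ∑ i ∈ Finset.range m, F.bsum (w i)| ≤
      m * (2 * F.C * F.k) := by
  induction m with
  | zero => simp [cat]
  | succ m ih =>
    rw [cat, ← List.append_assoc, Finset.sum_range_succ]
    have h1 := abs_le.1 (F.abs_bsum_append_sub_le (u ++ cat w m) (w m))
    have h2 := abs_le.1 ih
    push_cast
    rw [abs_le]; constructor <;> linarith

end Concatenation

section Blocks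

set_option linter.unusedSectionVars false

variable {B : Type} [Fintype B] [TopologicalSpace B] [DiscreteTopology B] [MeasurableSpace B]
  [BorelSpace B] {X : Set (ℕ → B)}

theorem measurable_prefixWord (n : ℕ) (c : List B → ℝ) :
    Measurable fun x : ↥X => c (prefixWord x.val n) :=
  (continuous_of_prefixWord n c).measurable

theorem integrable_prefixWord (μ : Measure ↥X) [IsProbabilityMeasure μ] (n : ℕ) (c : List B → ℝ) :
    Integrable (fun x : ↥X => c (prefixWord x.val n)) μ := by
  refine Integrable.of_bound (measurable_prefixWord n c).aestronglyMeasurable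
    (∑ u ∈ words B n, |c u|) (Eventually.of_forall fun x => ?_)
  exact Finset.single_le_sum (f := fun u => |c u|) (fun _ _ => abs_nonneg _)
    (mem_words.2 (by simp : (prefixWord x.val n).length = n))

theorem integrable_birkhoff (hX : Set.MapsTo shift X X) (μ : ProbabilityMeasure ↥X)
    (hμ : IsInvariant (subShift X) μ) {f : ↥X → ℝ} (hf : Integrable f μ.toMeasure) (n : ℕ) :
    Integrable (birkhoff (subShift X) f n) μ.toMeasure := by
  have hmp : MeasurePreserving (subShift X) μ.toMeasure μ.toMeasure :=
    ⟨(continuous_subShift hX).measurable, hμ⟩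
  exact integrable_finsetSum _ fun i _ => (hmp.iterate i).integrable_comp_of_integrable hf

theorem integral_birkhoff (hX : Set.MapsTo shift X X) (μ : ProbabilityMeasure ↥X)
    (hμ : IsInvariant (subShift X) μ) {f : ↥X → ℝ} (hf : Integrable f μ.toMeasure) (n : ℕ) :
    ∫ x, birkhoff (subShift X) f n x ∂μ.toMeasure = n * ∫ x, f x ∂μ.toMeasure := by
  have hmp : MeasurePreserving (subShift X) μ.toMeasure μ.toMeasure :=
    ⟨(continuous_subShift hX).measurable, hμ⟩
  unfold birkhoff
  have hi : ∀ i, Integrable (fun x => f ((subShift X)^[i] x)) μ.toMeasure := fun i =>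
    (hmp.iterate i).integrable_comp_of_integrable hf
  rw [integral_finsetSum _ fun i _ => hi i]
  have : ∀ i, ∫ x, f ((subShift X)^[i] x) ∂μ.toMeasure = ∫ x, f x ∂μ.toMeasure := by
    intro i
    conv_rhs => rw [← (hmp.iterate i).map_eq]
    rw [integral_map (hmp.iterate i).measurable.aemeasurable]
    rw [(hmp.iterate i).map_eq]
    exact hf.aestronglyMeasurable
  simp [this]

theorem abs_integral_bsum_sub_le (hX : Set.MapsTo shift X X) (μ : ProbabilityMeasure ↥X)
    (hμ : IsInvariant (subShift X) μ) (F : LocalFn B) (N : ℕ) :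
    |∫ x, F.bsum (prefixWord x.val N) ∂μ.toMeasure - N * ∫ x, F.ev x.val ∂μ.toMeasure| ≤
      2 * F.C * F.k := by
  have hF : Integrable (fun x : ↥X => F.ev x.val) μ.toMeasure :=
    integrable_prefixWord μ.toMeasure F.k F.toFun
  rw [← integral_birkhoff hX μ hμ hF N, ← integral_sub (integrable_prefixWord _ _ _)
    (integrable_birkhoff hX μ hμ hF N)]
  have := norm_integral_le_of_norm_le_const (μ := μ.toMeasure) (C := 2 * F.C * F.k)
    (f := fun x : ↥X => F.bsum (prefixWord x.val N) -
      birkhoff (subShift X) (fun y => F.ev y.val) N x)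
    (Eventually.of_forall fun x => by
      rw [Real.norm_eq_abs, abs_sub_comm]; exact abs_birkhoff_sub_bsum_le hX F x N)
  simpa using this

theorem exists_blocks (hX : Set.MapsTo shift X X) (μ : ProbabilityMeasure ↥X)
    (hμ : IsInvariant (subShift X) μ) {G : Set (List B)} {τ : ℕ} {g : ℕ → ℕ}
    (hg : Tendsto (fun n => (g n : ℝ) / n) atTop (𝓝 0))
    (hG : ∀ v ∈ G, ∀ w ∈ G, ∃ u : List B, u.length ≤ τ ∧ v ++ u ++ w ∈ G)
    (happ : ∀ w ∈ language X, ∃ v ∈ G, editDist v w ≤ g w.length)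
    {ι : Type*} [Fintype ι] (F : ι → LocalFn B) {ε : ℝ} (hε : 0 < ε) :
    ∃ (n d : ℕ) (T : Finset (List B)), 0 < n ∧ T.Nonempty ∧ (∀ W ∈ T, W.length = n) ∧
      Real.exp (n * (entropy X μ - ε)) ≤ T.card ∧
      (∀ W ∈ T, ∀ a u, |(F a).bsum (u ++ W) - (F a).bsum u -
        n * ∫ x, (F a).ev x.val ∂μ.toMeasure| ≤ ε * n) ∧
      (∀ W ∈ T, ∃ D, Near G W D ∧ D + τ ≤ d) ∧ d ≤ ε * n := by
  obtain ⟨N, hN0, hNε, hgN, hFN⟩ : ∃ N : ℕ, 0 < N ∧ 2 ≤ N * ε ∧ 2 * g N + τ ≤ ε * N ∧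
      ∀ a, 4 * (F a).C * (F a).k + 1 ≤ ε * N := by
    have h1 : ∀ᶠ N : ℕ in atTop, (g N : ℝ) / N < ε / 4 :=
      hg.eventually_lt_const (by positivity)
    have hN := tendsto_natCast_atTop_atTop (R := ℝ)
    have h2 : ∀ᶠ N : ℕ in atTop, 2 * (τ : ℝ) / ε ≤ N := hN.eventually_ge_atTop _
    have h3 : ∀ᶠ N : ℕ in atTop, 2 / ε ≤ N := hN.eventually_ge_atTop _
    have h4 : ∀ᶠ N : ℕ in atTop, ∀ a, (4 * (F a).C * (F a).k + 1) / ε ≤ N :=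
      eventually_all.2 fun a => hN.eventually_ge_atTop _
    obtain ⟨N, h1, h2, h3, h4, h5⟩ :=
      (h1.and (h2.and (h3.and (h4.and (eventually_gt_atTop 0))))).exists
    have hp : (0 : ℝ) < N := by exact_mod_cast h5
    rw [div_lt_iff₀ hp] at h1
    rw [div_le_iff₀ hε] at h2 h3
    refine ⟨N, h5, h3, by linarith, fun a => ?_⟩
    have := h4 a
    rw [div_le_iff₀ hε] at this
    linarith
  have hN0' : (0 : ℝ) < N := by exact_mod_cast hN0
  have hHN : N * entropy X μ ≤ wordEntropy X μ N := by
    obtain ⟨N', rfl⟩ : ∃ N', N = N' + 1 := ⟨N - 1, by omega⟩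
    have := ciInf_le (bddBelow_entropy μ) N'
    rw [le_div_iff₀ (by positivity)] at this
    push_cast
    rw [mul_comm]
    exact this
  let c : Option ι → List B → ℝ := fun a =>
    a.elim (fun u => Real.log (cylMass μ.toMeasure u)) fun a => (F a).bsum
  have hcH : ∫ x, c none (prefixWord x.val N) ∂μ.toMeasure = -wordEntropy X μ N := by
    rw [integral_prefixWord, wordEntropy_eq_sum, ← Finset.sum_neg_distrib]
    refine Finset.sum_congr rfl fun u _ => ?_
    simp [c, Real.negMulLog]
  obtain ⟨m, hm, hm0⟩ := ((eventually_half_le_sum_sub_le μ.toMeasure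
    (fun a x => c a (prefixWord x.val N)) (fun a => measurable_prefixWord N (c a))
    fun a => integrable_prefixWord μ.toMeasure N (c a)).and (eventually_gt_atTop 0)).exists
  have hm0' : (1 : ℝ) ≤ m := by exact_mod_cast hm0
  set P := Measure.infinitePi fun _ : ℕ => μ.toMeasure with hP
  set good := {ω : ℕ → ↥X | ∀ a, |∑ i ∈ Finset.range m, c a (prefixWord (ω i).val N) -
    m * ∫ y, c a (prefixWord y.val N) ∂μ.toMeasure| ≤ m} with hgood
  let bl : (ℕ → ↥X) → ℕ → List B := fun ω i => prefixWord (ω i).val N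
  have hlen : ∀ ω, (cat (bl ω) m).length = m * N := fun ω => by simp [length_cat, bl]
  let T : Finset (List B) := (words B (m * N)).filter fun W => ∃ ω ∈ good, cat (bl ω) m = W
  have hT : ∀ W ∈ T, ∃ ω ∈ good, cat (bl ω) m = W := fun W hW => (Finset.mem_filter.1 hW).2
  have hcard : Real.exp (m * N * (entropy X μ - ε)) ≤ T.card := by
    have hmass : ∀ W ∈ T, P.real {ω | cat (bl ω) m = W} ≤
        Real.exp (-(m * N * entropy X μ - m)) := by
      intro W hW
      obtain ⟨ω, hω, rfl⟩ := hT W hW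
      have hset : {ω' | cat (bl ω') m = cat (bl ω) m} =
          (Finset.range m : Set ℕ).pi fun i => (Subtype.val ⁻¹' cylinder (bl ω i) : Set ↥X) := by
        ext ω'
        simp only [mem_ofPred_eq, Set.mem_pi, Finset.coe_range, mem_Iio, mem_preimage,
          mem_cylinder_iff]
        constructor
        · intro h i hi
          have := eq_of_cat_eq (fun i _ => by simp [bl]) h i hi
          simpa [bl] using this
        · intro h
          have h' : ∀ i < m, bl ω' i = bl ω i := fun i hi => by simpa [bl] using h i hi
          have : ∀ j ≤ m, cat (bl ω') j = cat (bl ω) j := by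
            intro j
            induction j with
            | zero => intro _; rfl
            | succ j ih => intro hj; rw [cat, cat, ih (by omega), h' j (by omega)]
          exact this m le_rfl
      rw [hset, measureReal_def, Measure.infinitePi_pi _ fun i _ =>
        measurable_subtype_coe (measurableSet_cylinder _), ENNReal.toReal_prod]
      have h1 := (abs_le.1 (hω none)).2
      rw [hcH] at h1
      calc _ ≤ ∏ i ∈ Finset.range m, Real.exp (c none (bl ω i)) := by
            refine Finset.prod_le_prod (fun _ _ => ENNReal.toReal_nonneg) fun i _ => ?_
            exact Real.le_exp_log _
        _ = Real.exp (∑ i ∈ Finset.range m, c none (bl ω i)) := (Real.exp_sum _ _).symm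
        _ ≤ _ := by
            rw [Real.exp_le_exp]
            have : (m : ℝ) * (N * entropy X μ) ≤ m * wordEntropy X μ N := by gcongr
            have h2 : ∑ i ∈ Finset.range m, c none (bl ω i) =
              ∑ i ∈ Finset.range m, c none (prefixWord (ω i).val N) := rfl
            linarith
    have hcov : good ⊆ ⋃ W ∈ T, {ω | cat (bl ω) m = W} := by
      intro ω hω
      exact mem_iUnion₂.2 ⟨cat (bl ω) m, Finset.mem_filter.2 ⟨mem_words.2 (hlen ω), ω, hω, rfl⟩, rfl⟩
    have h1 : (1 / 2 : ℝ) ≤ T.card * Real.exp (-(m * N * entropy X μ - m)) :=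
      calc _ ≤ P.real good := hm
        _ ≤ P.real (⋃ W ∈ T, {ω | cat (bl ω) m = W}) := measureReal_mono hcov (measure_ne_top _ _)
        _ ≤ ∑ W ∈ T, P.real {ω | cat (bl ω) m = W} := measureReal_biUnion_finset_le _ _
        _ ≤ ∑ W ∈ T, Real.exp (-(m * N * entropy X μ - m)) := Finset.sum_le_sum hmass
        _ = _ := by simp
    have h2 : Real.exp (-m) ≤ 1 / 2 := by
      have : (2 : ℝ) ≤ Real.exp m := by
        have := Real.add_one_le_exp (m : ℝ); linarith
      rw [Real.exp_neg, one_div]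
      exact inv_anti₀ (by norm_num) this
    calc Real.exp (m * N * (entropy X μ - ε)) ≤
          Real.exp (-m) * Real.exp (m * N * entropy X μ - m) := by
          rw [← Real.exp_add, Real.exp_le_exp]
          nlinarith
      _ ≤ 1 / 2 * Real.exp (m * N * entropy X μ - m) := by gcongr
      _ ≤ T.card * Real.exp (-(m * N * entropy X μ - m)) *
          Real.exp (m * N * entropy X μ - m) := by gcongr
      _ = T.card := by rw [mul_assoc, ← Real.exp_add]; simp
  refine ⟨m * N, m * (2 * g N + τ), T, by positivity, ?_, fun W hW => ?_, ?_, ?_, ?_, ?_⟩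
  · rw [← Finset.card_pos]
    exact_mod_cast (Real.exp_pos _).trans_le hcard
  · exact mem_words.1 (Finset.mem_filter.1 hW).1
  · push_cast; exact hcard
  · intro W hW a u
    obtain ⟨ω, hω, rfl⟩ := hT W hW
    have h1 := abs_le.1 ((F a).abs_bsum_append_cat_le u (bl ω) m)
    have h2 := abs_le.1 (hω (some a))
    have h3 := abs_le.1 (abs_integral_bsum_sub_le hX μ hμ (F a) N)
    have h4 := hFN a
    simp only [c, Option.elim_some] at h2
    simp only [bl] at h1 ⊢
    set I := ∫ x, (F a).bsum (prefixWord x.val N) ∂μ.toMeasure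
    set J := ∫ x, (F a).ev x.val ∂μ.toMeasure
    have h5 : (m : ℝ) * (4 * (F a).C * (F a).k + 1) ≤ m * (ε * N) := by gcongr
    have h6 : (m : ℝ) * (-(2 * (F a).C * (F a).k)) ≤ m * (I - N * J) := by gcongr; exact h3.1
    have h7 : (m : ℝ) * (I - N * J) ≤ m * (2 * (F a).C * (F a).k) := by gcongr; exact h3.2
    push_cast
    rw [abs_le]; constructor <;> linarith
  · intro W hW
    obtain ⟨ω, hω, rfl⟩ := hT W hW
    refine Near.cat hG hm0 fun i _ => ?_
    obtain ⟨v, hv, hd⟩ := happ (bl ω i) ⟨(ω i).val, mem_cylinder_prefixWord _ _, (ω i).2⟩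
    refine ⟨v, hv, (Align.of_editDist_le hd).mono ?_⟩
    simp [bl]
  · push_cast
    nlinarith

end Blocks

section Schedules

/-- `jj l` is the stage containing the time `l` when stage `j` occupies the times
`L j ≤ l < L (j + 1)`. -/
structure Stages (L jj : ℕ → ℕ) : Prop where
  strictMono : StrictMono L
  zero : L 0 = 0
  le : ∀ l, L (jj l) ≤ l
  lt : ∀ l, l < L (jj l + 1)

theorem exists_stages {L : ℕ → ℕ} (hL : StrictMono L) (h0 : L 0 = 0) : ∃ jj, Stages L jj := by
  refine ⟨fun l => Nat.findGreatest (fun j => L j ≤ l) l, hL, h0, fun l => ?_, fun l => ?_⟩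
  · exact Nat.findGreatest_spec (P := fun j => L j ≤ l) (Nat.zero_le l) (by omega)
  · by_contra! h
    have h1 : Nat.findGreatest (fun j => L j ≤ l) l + 1 ≤ l := (hL.id_le _).trans h
    have := Nat.le_findGreatest (P := fun j => L j ≤ l) h1 h
    omega

namespace Stages

variable {L jj : ℕ → ℕ}

theorem eq_of_mem (h : Stages L jj) {j l : ℕ} (h1 : L j ≤ l) (h2 : l < L (j + 1)) : jj l = j := by
  have h3 := h.strictMono.lt_iff_lt.1 ((h.le l).trans_lt h2)
  have h4 := h.strictMono.lt_iff_lt.1 (h1.trans_lt (h.lt l))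
  omega

theorem apply_start (h : Stages L jj) (j : ℕ) : jj (L j) = j :=
  h.eq_of_mem le_rfl (h.strictMono (Nat.lt_succ_self j))

theorem le_of_start_le (h : Stages L jj) {j l : ℕ} (h1 : L j ≤ l) : j ≤ jj l :=
  Nat.lt_succ_iff.1 (h.strictMono.lt_iff_lt.1 (h1.trans_lt (h.lt l)))

theorem monotone (h : Stages L jj) : Monotone jj :=
  fun _ _ hl => h.le_of_start_le ((h.le _).trans hl)

theorem tendsto (h : Stages L jj) : Tendsto jj atTop atTop :=
  tendsto_atTop_atTop.2 fun j => ⟨L j, fun _ hl => h.le_of_start_le hl⟩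

end Stages

/-- The total length of the first `l` blocks. -/
def totLen (n : ℕ → ℕ) (jj : ℕ → ℕ) (l : ℕ) : ℕ := ∑ i ∈ Finset.range l, n (jj i)

theorem totLen_succ (n : ℕ → ℕ) (jj : ℕ → ℕ) (l : ℕ) :
    totLen n jj (l + 1) = totLen n jj l + n (jj l) := Finset.sum_range_succ _ _

theorem totLen_mono (n : ℕ → ℕ) (jj : ℕ → ℕ) : Monotone (totLen n jj) :=
  monotone_nat_of_le_succ fun l => by rw [totLen_succ]; omega

/-- Auxiliary recursion for the starting times and the total lengths of the stages. -/
def stageAux (n : ℕ → ℕ) : ℕ → ℕ × ℕ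
  | 0 => (0, 0)
  | j + 1 => ((stageAux n j).1 + (j + 1) * ((stageAux n j).2 + n (j + 1) + 1),
      (stageAux n j).2 + (j + 1) * ((stageAux n j).2 + n (j + 1) + 1) * n j)

theorem exists_schedule {n : ℕ → ℕ} (hn : ∀ j, 0 < n j) :
    ∃ L jj : ℕ → ℕ, Stages L jj ∧
      ∀ j, (j + 1) * (totLen n jj (L j) + n (j + 1)) ≤ totLen n jj (L (j + 1)) := by
  set L : ℕ → ℕ := fun j => (stageAux n j).1 with hL
  have hLs : ∀ j, L (j + 1) = L j + (j + 1) * ((stageAux n j).2 + n (j + 1) + 1) := fun j => rfl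
  have hmono : StrictMono L := strictMono_nat_of_lt_succ fun j => by
    rw [hLs]; exact Nat.lt_add_of_pos_right (by positivity)
  obtain ⟨jj, hjj⟩ := exists_stages hmono rfl
  have htot : ∀ j, totLen n jj (L j) = (stageAux n j).2 := by
    intro j
    induction j with
    | zero => rfl
    | succ j ih =>
      have : ∀ i ∈ Finset.range ((j + 1) * ((stageAux n j).2 + n (j + 1) + 1)),
          n (jj (L j + i)) = n j := by
        intro i hi
        rw [hjj.eq_of_mem (j := j) (by omega)]
        rw [hLs]
        have := Finset.mem_range.1 hi
        omega
      rw [totLen] at ih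
      rw [totLen, hLs, Finset.sum_range_add, ih, Finset.sum_congr rfl this, Finset.sum_const,
        Finset.card_range, smul_eq_mul]
      rfl
  refine ⟨L, jj, hjj, fun j => ?_⟩
  rw [htot, htot]
  have h1 : (stageAux n (j + 1)).2 = (stageAux n j).2 +
      (j + 1) * ((stageAux n j).2 + n (j + 1) + 1) * n j := rfl
  rw [h1]
  calc _ ≤ (j + 1) * ((stageAux n j).2 + n (j + 1) + 1) * 1 := by
        rw [mul_one]; exact Nat.mul_le_mul_left _ (by omega)
    _ ≤ (j + 1) * ((stageAux n j).2 + n (j + 1) + 1) * n j := Nat.mul_le_mul_left _ (hn j)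
    _ ≤ _ := Nat.le_add_left _ _

open Asymptotics

variable {n L jj : ℕ → ℕ}

theorem tendsto_totLen (hn : ∀ j, 0 < n j) :
    Tendsto (fun l => (totLen n jj l : ℝ)) atTop atTop := by
  refine tendsto_natCast_atTop_atTop.comp (tendsto_atTop_mono (fun l => ?_) tendsto_id)
  calc l = ∑ i ∈ Finset.range l, 1 := by simp
    _ ≤ _ := Finset.sum_le_sum fun i _ => hn _

theorem isLittleO_blockLen (h : Stages L jj)
    (hd : ∀ j, (j + 1) * (totLen n jj (L j) + n (j + 1)) ≤ totLen n jj (L (j + 1))) :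
    (fun l => (n (jj l) : ℝ)) =o[atTop] fun l => (totLen n jj l : ℝ) := by
  rw [isLittleO_iff]
  intro c hc
  have h1 : ∀ᶠ l in atTop, 1 / c ≤ (jj l : ℝ) :=
    (tendsto_natCast_atTop_atTop.comp h.tendsto).eventually_ge_atTop _
  filter_upwards [h1, h.tendsto.eventually_gt_atTop 0] with l h1 h2
  simp only [Real.norm_natCast]
  obtain ⟨j, hj⟩ : ∃ j, jj l = j + 1 := ⟨jj l - 1, by omega⟩
  have h3 : (j + 1) * n (j + 1) ≤ totLen n jj l :=
    (Nat.mul_le_mul_left _ (Nat.le_add_left _ _)).trans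
      ((hd j).trans (totLen_mono _ _ (hj ▸ h.le l)))
  have h3' : ((j : ℝ) + 1) * n (j + 1) ≤ totLen n jj l := by exact_mod_cast h3
  rw [hj] at h1 ⊢
  push_cast at h1
  rw [div_le_iff₀ hc] at h1
  calc (n (j + 1) : ℝ) = 1 * n (j + 1) := (one_mul _).symm
    _ ≤ ((j + 1) * c) * n (j + 1) := by gcongr
    _ = c * ((j + 1) * n (j + 1)) := by ring
    _ ≤ _ := by gcongr

theorem isLittleO_weighted_sum (h : Stages L jj)
    (hd : ∀ j, (j + 1) * (totLen n jj (L j) + n (j + 1)) ≤ totLen n jj (L (j + 1)))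
    {a : ℕ → ℝ} {b : ℝ} (hb : ∀ j, |a j| ≤ b)
    (ha : Tendsto (fun j => a (j + 1) - a j) atTop (𝓝 0)) :
    (fun l => ∑ i ∈ Finset.range l, n (jj i) * a (jj i) - totLen n jj l * a (jj l))
      =o[atTop] fun l => (totLen n jj l : ℝ) := by
  have hb0 : 0 ≤ b := (abs_nonneg _).trans (hb 0)
  rw [isLittleO_iff]
  intro c hc
  have h1 : ∀ᶠ j : ℕ in atTop, 4 * b / c ≤ (j : ℝ) :=
    tendsto_natCast_atTop_atTop.eventually_ge_atTop _
  have h2 : ∀ᶠ j : ℕ in atTop, |a (j + 1) - a j| < c / 2 := by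
    have := ha.abs
    rw [abs_zero] at this
    exact this.eventually_lt_const (by positivity)
  obtain ⟨j0, hj0⟩ := eventually_atTop.1 (h1.and h2)
  filter_upwards [h.tendsto.eventually_gt_atTop j0] with l hl
  obtain ⟨j, hj⟩ : ∃ j, jj l = j + 1 := ⟨jj l - 1, by omega⟩
  obtain ⟨h1, h2⟩ := hj0 j (by omega)
  rw [div_le_iff₀ hc] at h1
  simp only [Real.norm_eq_abs]
  have e : ∑ i ∈ Finset.range l, (n (jj i) : ℝ) * a (jj i) - totLen n jj l * a (jj l) =
      ∑ i ∈ Finset.range l, n (jj i) * (a (jj i) - a (j + 1)) := by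
    rw [hj, totLen]; push_cast
    rw [Finset.sum_mul, ← Finset.sum_sub_distrib]
    simp only [mul_sub]
  rw [e]
  have hLl : L (j + 1) ≤ l := hj ▸ h.le l
  have hLL : L j ≤ l := (h.strictMono.monotone (Nat.le_succ j)).trans hLl
  calc _ ≤ ∑ i ∈ Finset.range l, |n (jj i) * (a (jj i) - a (j + 1))| :=
        Finset.abs_sum_le_sum_abs _ _
    _ ≤ ∑ i ∈ Finset.range l, (n (jj i) * (c / 2) + if i < L j then n (jj i) * (2 * b) else 0) := by
        refine Finset.sum_le_sum fun i hi => ?_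
        have hi := Finset.mem_range.1 hi
        rw [abs_mul, Nat.abs_cast]
        split_ifs with hij
        · rw [← mul_add]
          gcongr
          have h3 := abs_le.1 (hb (jj i))
          have h4 := abs_le.1 (hb (j + 1))
          rw [abs_le]; constructor <;> linarith
        · rw [add_zero]
          gcongr
          have h3 : j ≤ jj i := h.le_of_start_le (not_lt.1 hij)
          have h4 : jj i ≤ j + 1 := hj ▸ h.monotone hi.le
          rcases (by omega : jj i = j ∨ jj i = j + 1) with h5 | h5
          · rw [h5, abs_sub_comm]; exact h2.le
          · rw [h5, sub_self, abs_zero]; positivity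
    _ = totLen n jj l * (c / 2) + totLen n jj (L j) * (2 * b) := by
        rw [Finset.sum_add_distrib, ← Finset.sum_mul, ← Finset.sum_filter, ← Finset.sum_mul]
        have : (Finset.range l).filter (fun i => i < L j) = Finset.range (L j) := by
          ext i; simp; omega
        rw [this, totLen, totLen]; push_cast; rfl
    _ ≤ totLen n jj l * (c / 2) + totLen n jj l * (c / 2) := by
        refine add_le_add le_rfl ?_
        have h3 : (j + 1) * totLen n jj (L j) ≤ totLen n jj l :=
          (Nat.mul_le_mul_left _ (Nat.le_add_right _ _)).trans ((hd j).trans (totLen_mono _ _ hLl))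
        have h3' : ((j : ℝ) + 1) * totLen n jj (L j) ≤ totLen n jj l := by exact_mod_cast h3
        have h4 : (0 : ℝ) ≤ totLen n jj (L j) := Nat.cast_nonneg _
        nlinarith [mul_le_mul_of_nonneg_left h1 h4, mul_le_mul_of_nonneg_right h3' hc.le,
          mul_nonneg h4 hc.le]
    _ = _ := by rw [Nat.abs_cast]; ring

end Schedules

section Paths

theorem exists_chain {Y : Type*} [PseudoMetricSpace Y] [PreconnectedSpace Y] {ε : ℝ} (hε : 0 < ε)
    (a b : Y) : ∃ (c : ℕ → Y) (m : ℕ), 0 < m ∧ c 0 = a ∧ c m = b ∧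
      ∀ i < m, dist (c i) (c (i + 1)) < ε := by
  set R : Set Y := {b | ∃ (c : ℕ → Y) (m : ℕ), 0 < m ∧ c 0 = a ∧ c m = b ∧
      ∀ i < m, dist (c i) (c (i + 1)) < ε} with hR
  have hstep : ∀ b ∈ R, ∀ b', dist b b' < ε → b' ∈ R := by
    rintro b ⟨c, m, hm, h0, rfl, hc⟩ b' hb
    refine ⟨Function.update c (m + 1) b', m + 1, by omega, ?_, by simp, fun i hi => ?_⟩
    · rw [Function.update_of_ne (by omega)]; exact h0
    · rw [Function.update_of_ne (by omega)]
      rcases Nat.lt_succ_iff_lt_or_eq.1 hi with hi | rfl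
      · rw [Function.update_of_ne (by omega)]; exact hc i hi
      · simpa using hb
  have hopen : IsOpen R := Metric.isOpen_iff.2 fun b hb =>
    ⟨ε, hε, fun b' hb' => hstep b hb b' (by rw [dist_comm]; exact hb')⟩
  have hclosed : IsClosed R := by
    rw [← isOpen_compl_iff]
    exact Metric.isOpen_iff.2 fun b hb => ⟨ε, hε, fun b' hb' hb'R => hb (hstep b' hb'R b hb')⟩
  have ha : a ∈ R := ⟨fun _ => a, 1, one_pos, rfl, rfl, fun i _ => by simpa using hε⟩
  have : R = univ := IsClopen.eq_univ ⟨hclosed, hopen⟩ ⟨a, ha⟩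
  exact (this ▸ mem_univ b : b ∈ R)

theorem exists_slow_dense_sequence (Y : Type*) [MetricSpace Y] [CompactSpace Y] [ConnectedSpace Y] :
    ∃ α : ℕ → Y, Tendsto (fun j => dist (α j) (α (j + 1))) atTop (𝓝 0) ∧
      ∀ y, ∃ s : ℕ → ℕ, StrictMono s ∧ Tendsto (α ∘ s) atTop (𝓝 y) := by
  set p : ℕ → Y := fun i => TopologicalSpace.denseSeq Y (Nat.unpair i).1 with hp
  choose c m hm hc0 hcm hc using fun i : ℕ =>
    exists_chain (show (0 : ℝ) < 1 / ((i : ℝ) + 1) by positivity) (p i) (p (i + 1))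
  set L : ℕ → ℕ := fun j => ∑ i ∈ Finset.range j, m i with hL
  have hLs : ∀ j, L (j + 1) = L j + m j := fun j => Finset.sum_range_succ _ _
  have hmono : StrictMono L := strictMono_nat_of_lt_succ fun j => by
    rw [hLs]; exact Nat.lt_add_of_pos_right (hm j)
  obtain ⟨jj, hjj⟩ := exists_stages hmono rfl
  set α : ℕ → Y := fun l => c (jj l) (l - L (jj l)) with hα
  have hαL : ∀ j, α (L j) = p j := fun j => by
    simp only [hα, hjj.apply_start, Nat.sub_self, hc0]
  refine ⟨α, ?_, fun y => ?_⟩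
  · have hle : ∀ l, dist (α l) (α (l + 1)) ≤ 1 / ((jj l : ℝ) + 1) := by
      intro l
      have h1 := hjj.le l
      have h2 := hjj.lt l
      have h3 := hLs (jj l)
      have key : α (l + 1) = c (jj l) (l - L (jj l) + 1) := by
        rcases (Nat.succ_le_of_lt h2).lt_or_eq with h | h
        · have : jj (l + 1) = jj l := hjj.eq_of_mem (by omega) h
          simp only [hα, this]
          congr 1; omega
        · rw [show l + 1 = L (jj l + 1) from h, hαL, ← hcm]
          congr 1; omega
      rw [key]
      exact (hc _ _ (by omega)).le
    exact squeeze_zero (fun _ => dist_nonneg) hle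
      (tendsto_one_div_add_atTop_nhds_zero_nat.comp hjj.tendsto)
  · apply MapClusterPt.tendsto_subseq
    rw [mapClusterPt_iff_frequently]
    intro s hs
    obtain ⟨δ, hδ, hδs⟩ := Metric.mem_nhds_iff.1 hs
    obtain ⟨k, hk⟩ := (TopologicalSpace.denseRange_denseSeq Y).exists_dist_lt y hδ
    rw [frequently_atTop]
    intro l0
    refine ⟨L (Nat.pair k l0), (Nat.right_le_pair k l0).trans (hmono.id_le _), ?_⟩
    apply hδs
    rw [hαL, Metric.mem_ball, dist_comm]
    simpa [hp] using hk

theorem exists_slow_dense_sequence_of_isConnected {Y : Type*} [TopologicalSpace Y]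
    [TopologicalSpace.MetrizableSpace Y] {K : Set Y} (hK : IsCompact K) (hK' : IsConnected K) :
    ∃ α : ℕ → Y, (∀ j, α j ∈ K) ∧
      (∀ f : Y → ℝ, Continuous f → Tendsto (fun j => f (α (j + 1)) - f (α j)) atTop (𝓝 0)) ∧
      ∀ y ∈ K, ∃ s : ℕ → ℕ, StrictMono s ∧ Tendsto (α ∘ s) atTop (𝓝 y) := by
  let _ : MetricSpace Y := TopologicalSpace.metrizableSpaceMetric Y
  have : CompactSpace ↥K := isCompact_iff_compactSpace.1 hK
  have : ConnectedSpace ↥K := isConnected_iff_connectedSpace.1 hK'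
  obtain ⟨α, h1, h2⟩ := exists_slow_dense_sequence ↥K
  refine ⟨fun j => (α j).val, fun j => (α j).2, fun f hf => ?_, fun y hy => ?_⟩
  · have hu : UniformContinuous fun y : ↥K => f y.val :=
      CompactSpace.uniformContinuous_of_continuous (hf.comp continuous_subtype_val)
    rw [Metric.tendsto_atTop]
    intro ε hε
    obtain ⟨δ, hδ, hδε⟩ := Metric.uniformContinuous_iff.1 hu ε hε
    obtain ⟨N, hN⟩ := eventually_atTop.1 (h1.eventually_lt_const hδ)
    refine ⟨N, fun j hj => ?_⟩
    have := hδε (hN j hj)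
    rw [Real.dist_eq, abs_sub_comm] at this
    simpa [Real.dist_eq] using this
  · obtain ⟨s, hs, hlim⟩ := h2 ⟨y, hy⟩
    exact ⟨s, hs, (continuous_subtype_val.tendsto _).comp hlim⟩

end Paths

section Concatenation

variable {B : Type}

theorem cylinder_anti {v w : List B} (h : v <+: w) : cylinder w ⊆ cylinder v := by
  intro x hx
  rw [mem_cylinder_iff] at hx ⊢
  rw [← take_prefixWord x h.length_le, hx]
  exact (List.prefix_iff_eq_take.1 h).symm

theorem iterate_shift_mem_cylinder {u v : List B} {x : ℕ → B} (hx : x ∈ cylinder (u ++ v)) :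
    shift^[u.length] x ∈ cylinder v := by
  rw [mem_cylinder_iff] at hx ⊢
  rw [List.length_append, prefixWord_add] at hx
  have := (List.append_inj hx (by simp)).2
  convert this using 2
  ext i
  exact iterate_shift_apply x _ i

theorem mem_language_of_append {X : Set (ℕ → B)} (hX : MapsTo shift X X) {u v : List B}
    (h : u ++ v ∈ language X) : v ∈ language X := by
  obtain ⟨x, hx, hxX⟩ := h
  exact ⟨_, iterate_shift_mem_cylinder hx, hX.iterate _ hxX⟩

theorem isClosed_cylinder [TopologicalSpace B] [DiscreteTopology B] (w : List B) :
    IsClosed (cylinder w) := by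
  have : cylinder w = ⋂ i : Fin w.length, (fun x : ℕ → B => x i) ⁻¹' {w.get i} := by
    ext x; simp [cylinder]
  rw [this]
  exact isClosed_iInter fun i => (isClosed_discrete _).preimage (continuous_apply _)

theorem exists_mem_iInter_cylinder [Finite B] [TopologicalSpace B] [DiscreteTopology B]
    {X : Set (ℕ → B)} (hXcl : IsClosed X) {q : ℕ → List B} (hq : ∀ l, q l <+: q (l + 1))
    (hqX : ∀ l, q l ∈ language X) : ∃ x ∈ X, ∀ l, x ∈ cylinder (q l) := by
  have hcl : ∀ l, IsClosed (cylinder (q l) ∩ X) := fun l => (isClosed_cylinder _).inter hXcl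
  obtain ⟨x, hx⟩ := IsCompact.nonempty_iInter_of_sequence_nonempty_isCompact_isClosed
    (fun l => cylinder (q l) ∩ X) (fun l => inter_subset_inter_left _ (cylinder_anti (hq l)))
    hqX (hcl 0).isCompact hcl
  exact ⟨x, (mem_iInter.1 hx 0).2, fun l => (mem_iInter.1 hx l).1⟩

variable {G : Set (List B)} {τ : ℕ}

theorem exists_gluing (hG : ∀ v ∈ G, ∀ w ∈ G, ∃ u : List B, u.length ≤ τ ∧ v ++ u ++ w ∈ G)
    {g : List B} (hg : g ∈ G) {W : ℕ → List B} {δ : ℕ → ℕ}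
    (hW : ∀ l, ∃ D, Near G (W l) D ∧ D + τ ≤ δ l) :
    ∃ q : ℕ → List B, (∀ l, g ++ q l ∈ G) ∧ (∀ l, q l <+: q (l + 1)) ∧
      ∀ l, Align (q l) (cat W l) (∑ i ∈ Finset.range l, δ i) ∧
        Align (cat W l) (q l) (∑ i ∈ Finset.range l, δ i) := by
  have hstep : ∀ l (q : List B), ∃ r : List B, (g ++ q ∈ G → g ++ (q ++ r) ∈ G) ∧
      Align r (W l) (δ l) := by
    intro l q
    obtain ⟨D, ⟨V, hV, hA⟩, hD⟩ := hW l
    by_cases hq : g ++ q ∈ G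
    · obtain ⟨u, hu, hG'⟩ := hG _ hq _ hV
      refine ⟨u ++ V, fun _ => by simpa using hG', ?_⟩
      have h1 : Align ([] ++ u) [] (0 + u.length) := (Align.nil 0).append_left u
      simpa using (h1.append hA).mono (by omega)
    · obtain ⟨u, hu, hG'⟩ := hG _ hV _ hV
      exact ⟨V, fun h => absurd h hq, hA.mono (by omega)⟩
  choose r hr hrA using hstep
  let q : ℕ → List B := fun l => Nat.rec [] (fun l q => q ++ r l q) l
  have hq : ∀ l, q (l + 1) = q l ++ r l (q l) := fun l => rfl
  have hA : ∀ l, Align (q l) (cat W l) (∑ i ∈ Finset.range l, δ i) := by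
    intro l
    induction l with
    | zero => exact Align.nil _
    | succ l ih =>
      rw [hq, Finset.sum_range_succ]
      exact ih.append (hrA l _)
  refine ⟨q, fun l => ?_, fun l => by rw [hq]; exact List.prefix_append _ _,
    fun l => ⟨hA l, (hA l).symm⟩⟩
  induction l with
  | zero => simpa [q] using hg
  | succ l ih => exact hr l _ ih

theorem exists_point [Finite B] [TopologicalSpace B] [DiscreteTopology B] {X : Set (ℕ → B)}
    (hXcl : IsClosed X) (hX : MapsTo shift X X) (hGX : G ⊆ language X) (hGne : G.Nonempty)
    (hG : ∀ v ∈ G, ∀ w ∈ G, ∃ u : List B, u.length ≤ τ ∧ v ++ u ++ w ∈ G)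
    {W : ℕ → List B} {δ : ℕ → ℕ} (hW : ∀ l, ∃ D, Near G (W l) D ∧ D + τ ≤ δ l) :
    ∃ x ∈ X, ∀ l n, (cat W l).length + ∑ i ∈ Finset.range l, δ i ≤ n →
      Align (prefixWord x n) (cat W l)
        (2 * ∑ i ∈ Finset.range l, δ i + (n - (cat W l).length)) := by
  obtain ⟨g, hg⟩ := hGne
  obtain ⟨q, hqG, hq, hA⟩ := exists_gluing hG hg hW
  obtain ⟨x, hxX, hx⟩ := exists_mem_iInter_cylinder hXcl hq
    fun l => mem_language_of_append hX (hGX (hqG l))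
  refine ⟨x, hxX, fun l n hn => ?_⟩
  have h1 := (hA l).1.length_le
  have h2 := (hA l).2.length_le
  obtain ⟨m, rfl⟩ := Nat.exists_eq_add_of_le (show (q l).length ≤ n by omega)
  rw [prefixWord_add, mem_cylinder_iff.1 (hx l)]
  refine ((hA l).1.append_left _).mono ?_
  rw [length_prefixWord]
  omega

end Concatenation

section Schemes

open Asymptotics

/-- Words of length `n j`, each within `d j` edits (gluing included) of `G`, to be concatenated
during stage `j`, together with a schedule for the stages. -/
structure Scheme {B : Type} (G : Set (List B)) (τ : ℕ) where
  /-- the length of the words of stage `j` -/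
  n : ℕ → ℕ
  /-- the number of edits allowed for the words of stage `j` -/
  d : ℕ → ℕ
  /-- the words of stage `j` -/
  T : ℕ → Finset (List B)
  /-- the starting times of the stages -/
  L : ℕ → ℕ
  /-- the stage containing a given time -/
  jj : ℕ → ℕ
  pos : ∀ j, 0 < n j
  nonempty : ∀ j, (T j).Nonempty
  length_eq : ∀ j, ∀ W ∈ T j, W.length = n j
  near : ∀ j, ∀ W ∈ T j, ∃ D, Near G W D ∧ D + τ ≤ d j
  isLittleO : (fun j => (d j : ℝ)) =o[atTop] fun j => (n j : ℝ)
  stages : Stages L jj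
  dominates : ∀ j, (j + 1) * (totLen n jj (L j) + n (j + 1)) ≤ totLen n jj (L (j + 1))

namespace Scheme

variable {B : Type} {G : Set (List B)} {τ : ℕ} (S : Scheme G τ)

/-- The total length of the first `l` words. -/
def tot (l : ℕ) : ℕ := totLen S.n S.jj l

/-- The total number of edits allowed for the first `l` words. -/
def cost (l : ℕ) : ℕ := totLen S.d S.jj l

/-- A bound for the number of edits between a prefix of a glued point and the concatenation of
the first `l` words, when these are the words reached by that prefix. -/
def err (l : ℕ) : ℕ := 3 * S.cost l + (S.n (S.jj l) + S.d (S.jj l))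

theorem tot_succ (l : ℕ) : S.tot (l + 1) = S.tot l + S.n (S.jj l) := totLen_succ _ _ _

theorem cost_succ (l : ℕ) : S.cost (l + 1) = S.cost l + S.d (S.jj l) := totLen_succ _ _ _

theorem tendsto_tot : Tendsto (fun l => (S.tot l : ℝ)) atTop atTop := tendsto_totLen S.pos

theorem isLittleO_comp_jj :
    (fun l => (S.d (S.jj l) : ℝ)) =o[atTop] fun l => (S.n (S.jj l) : ℝ) :=
  S.isLittleO.comp_tendsto S.stages.tendsto

theorem isLittleO_sum {f : ℕ → ℝ} (hf : f =o[atTop] fun l => (S.n (S.jj l) : ℝ)) :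
    (fun l => ∑ i ∈ Finset.range l, f i) =o[atTop] fun l => (S.tot l : ℝ) := by
  have e : (fun l => (S.tot l : ℝ)) = fun l => ∑ i ∈ Finset.range l, (S.n (S.jj i) : ℝ) := by
    ext l; simp [tot, totLen]
  rw [e]
  exact hf.sum_range (fun _ => Nat.cast_nonneg _) (e ▸ S.tendsto_tot)

theorem isLittleO_cost : (fun l => (S.cost l : ℝ)) =o[atTop] fun l => (S.tot l : ℝ) := by
  have := S.isLittleO_sum S.isLittleO_comp_jj
  simpa [cost, totLen] using this

theorem isLittleO_err : (fun l => (S.err l : ℝ)) =o[atTop] fun l => (S.tot l : ℝ) := by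
  have h1 : (fun l => (S.n (S.jj l) : ℝ)) =o[atTop] fun l => (S.tot l : ℝ) :=
    isLittleO_blockLen S.stages S.dominates
  have := (S.isLittleO_cost.const_mul_left 3).add (h1.add (S.isLittleO_comp_jj.trans h1))
  simpa [err] using this

theorem exists_level : ∃ κ, Stages (fun l => S.tot l + S.cost l) κ :=
  exists_stages (strictMono_nat_of_lt_succ fun l => by
    have := S.pos (S.jj l)
    rw [tot_succ, cost_succ]; omega) rfl

/-- The number of words reached by the prefix of length `N` of a glued point. -/
noncomputable def level : ℕ → ℕ := S.exists_level.choose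

theorem stages_level : Stages (fun l => S.tot l + S.cost l) S.level := S.exists_level.choose_spec

theorem tot_level_le (N : ℕ) : S.tot (S.level N) ≤ N :=
  (Nat.le_add_right _ _).trans (S.stages_level.le N)

theorem le_tot_level_add (N : ℕ) : N ≤ S.tot (S.level N) + S.err (S.level N) := by
  have := S.stages_level.lt N
  simp only [tot_succ, cost_succ] at this
  rw [err]; omega

theorem isLittleO_comp_level {f : ℕ → ℝ} (hf : f =o[atTop] fun l => (S.tot l : ℝ)) :
    (fun N => f (S.level N)) =o[atTop] fun N : ℕ => (N : ℝ) := by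
  refine (hf.comp_tendsto S.stages_level.tendsto).trans_isBigO (IsBigO.of_bound 1 ?_)
  refine Eventually.of_forall fun N => ?_
  simpa using S.tot_level_le N

/-- The point `x` follows the sequence `W` of words of the scheme. -/
def Follows (x : ℕ → B) (W : ℕ → List B) : Prop :=
  ∀ N, Align (prefixWord x N) (cat W (S.level N)) (S.err (S.level N))

variable {S}

theorem length_cat_eq {W : ℕ → List B} (hW : ∀ l, W l ∈ S.T (S.jj l)) (l : ℕ) :
    (cat W l).length = S.tot l := by
  rw [length_cat, tot, totLen]
  exact Finset.sum_congr rfl fun i _ => S.length_eq _ _ (hW i)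

variable (S) in
theorem exists_follows [Finite B] [TopologicalSpace B] [DiscreteTopology B] {X : Set (ℕ → B)}
    (hXcl : IsClosed X) (hX : MapsTo shift X X) (hGX : G ⊆ language X) (hGne : G.Nonempty)
    (hG : ∀ v ∈ G, ∀ w ∈ G, ∃ u : List B, u.length ≤ τ ∧ v ++ u ++ w ∈ G)
    {W : ℕ → List B} (hW : ∀ l, W l ∈ S.T (S.jj l)) : ∃ x : ↥X, S.Follows x.val W := by
  obtain ⟨x, hxX, hx⟩ := exists_point hXcl hX hGX hGne hG fun l => S.near _ _ (hW l)
  refine ⟨⟨x, hxX⟩, fun N => (hx (S.level N) N ?_).mono ?_⟩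
  · rw [length_cat_eq hW]
    exact S.stages_level.le N
  · rw [length_cat_eq hW]
    have := S.stages_level.lt N
    simp only [tot_succ, cost_succ] at this
    have e : ∑ i ∈ Finset.range (S.level N), S.d (S.jj i) = S.cost (S.level N) := rfl
    rw [err, e]; omega

theorem abs_bsum_cat_sub_le (F : LocalFn B) {W : ℕ → List B} {I ε : ℕ → ℝ} {l : ℕ}
    (h : ∀ i < l, ∀ u, |F.bsum (u ++ W i) - F.bsum u - S.n (S.jj i) * I (S.jj i)| ≤
      ε (S.jj i) * S.n (S.jj i)) :
    |F.bsum (cat W l) - ∑ i ∈ Finset.range l, S.n (S.jj i) * I (S.jj i)| ≤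
      ∑ i ∈ Finset.range l, ε (S.jj i) * S.n (S.jj i) := by
  have h0 : F.bsum [] = 0 := by
    have := F.abs_bsum_le []
    simpa using this
  have e : F.bsum (cat W l) =
      ∑ i ∈ Finset.range l, (F.bsum (cat W i ++ W i) - F.bsum (cat W i)) := by
    have := Finset.sum_range_sub (fun i => F.bsum (cat W i)) l
    simp only [cat, h0, sub_zero] at this
    exact this.symm
  rw [e, ← Finset.sum_sub_distrib]
  exact (Finset.abs_sum_le_sum_abs _ _).trans
    (Finset.sum_le_sum fun i hi => h i (Finset.mem_range.1 hi) _)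

theorem isLittleO_bsum_cat_sub (F : LocalFn B) {W : ℕ → List B} {I ε : ℕ → ℝ}
    (hε : Tendsto ε atTop (𝓝 0)) (hI : ∀ j, |I j| ≤ F.C)
    (hI' : Tendsto (fun j => I (j + 1) - I j) atTop (𝓝 0))
    (h : ∀ᶠ l in atTop, ∀ u, |F.bsum (u ++ W l) - F.bsum u - S.n (S.jj l) * I (S.jj l)| ≤
      ε (S.jj l) * S.n (S.jj l)) :
    (fun l => F.bsum (cat W l) - S.tot l * I (S.jj l)) =o[atTop] fun l => (S.tot l : ℝ) := by
  have h0 : F.bsum [] = 0 := by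
    have := F.abs_bsum_le []
    simpa using this
  have h1 : (fun l => F.bsum (cat W l ++ W l) - F.bsum (cat W l) - S.n (S.jj l) * I (S.jj l))
      =o[atTop] fun l => (S.n (S.jj l) : ℝ) := by
    have h2 : (fun l => ε (S.jj l) * (S.n (S.jj l) : ℝ)) =o[atTop]
        fun l => (S.n (S.jj l) : ℝ) := by
      have := ((isLittleO_one_iff ℝ).2 (hε.comp S.stages.tendsto)).mul_isBigO
        (isBigO_refl (fun l => (S.n (S.jj l) : ℝ)) atTop)
      simpa using this
    refine IsBigO.trans_isLittleO (IsBigO.of_bound 1 ?_) h2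
    filter_upwards [h] with l hl
    rw [one_mul, Real.norm_eq_abs, Real.norm_eq_abs]
    exact (hl _).trans (le_abs_self _)
  have h3 := (S.isLittleO_sum h1).add (isLittleO_weighted_sum S.stages S.dominates hI hI')
  refine h3.congr_left fun l => ?_
  have := Finset.sum_range_sub (fun i => F.bsum (cat W i)) l
  simp only [cat, h0, sub_zero] at this
  rw [Finset.sum_sub_distrib, this]
  simp only [tot]
  ring

theorem Follows.isLittleO_birkhoff {X : Set (ℕ → B)} (hX : MapsTo shift X X) {x : ↥X}
    {W : ℕ → List B} (hx : S.Follows x.val W) (F : LocalFn B) {I : ℕ → ℝ}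
    (hI : ∀ j, |I j| ≤ F.C)
    (h : (fun l => F.bsum (cat W l) - S.tot l * I (S.jj l)) =o[atTop] fun l => (S.tot l : ℝ)) :
    Tendsto (fun N => birkAvg (subShift X) (fun y => F.ev y.val) N x - I (S.jj (S.level N)))
      atTop (𝓝 0) := by
  have hC := F.C_nonneg
  have h1 : (fun N : ℕ => birkhoff (subShift X) (fun y => F.ev y.val) N x -
      F.bsum (prefixWord x.val N)) =o[atTop] fun N : ℕ => (N : ℝ) := by
    refine IsBigO.trans_isLittleO (g := fun _ => (1 : ℝ)) (IsBigO.of_bound (2 * F.C * F.k) ?_) ?_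
    · exact Eventually.of_forall fun N => by
        simpa using abs_birkhoff_sub_bsum_le hX F x N
    · rw [isLittleO_one_left_iff]
      simpa using tendsto_natCast_atTop_atTop (R := ℝ)
  have he : (fun N => (S.err (S.level N) : ℝ)) =o[atTop] fun N : ℕ => (N : ℝ) :=
    S.isLittleO_comp_level S.isLittleO_err
  have h2 : (fun N : ℕ => F.bsum (prefixWord x.val N) - F.bsum (cat W (S.level N)))
      =o[atTop] fun N : ℕ => (N : ℝ) := by
    refine IsBigO.trans_isLittleO (IsBigO.of_bound (F.C * (4 * F.k + 1)) ?_) he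
    exact Eventually.of_forall fun N => by
      simpa using F.abs_bsum_sub_le_of_align (hx N)
  have h3 := S.isLittleO_comp_level h
  have h4 : (fun N : ℕ => ((S.tot (S.level N) : ℝ) - N) * I (S.jj (S.level N)))
      =o[atTop] fun N : ℕ => (N : ℝ) := by
    refine IsBigO.trans_isLittleO (IsBigO.of_bound F.C ?_) he
    refine Eventually.of_forall fun N => ?_
    have h5 : (S.tot (S.level N) : ℝ) ≤ N := by exact_mod_cast S.tot_level_le N
    have h6 : (N : ℝ) ≤ S.tot (S.level N) + S.err (S.level N) := by
      exact_mod_cast S.le_tot_level_add N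
    rw [norm_mul, Real.norm_eq_abs, Real.norm_eq_abs, Real.norm_natCast, mul_comm]
    refine mul_le_mul (hI _) ?_ (abs_nonneg _) hC
    rw [abs_le]; constructor <;> linarith
  have h5 := ((h1.add h2).add (h3.add h4)).tendsto_div_nhds_zero
  refine h5.congr' ?_
  filter_upwards [eventually_gt_atTop 0] with N hN
  have : (N : ℝ) ≠ 0 := by positivity
  rw [birkAvg]
  field_simp
  ring

end Scheme

end Schemes

section Saturation

set_option linter.unusedSectionVars false

theorem limitPts_eq_of_tendsto {Y : Type*} [TopologicalSpace Y] [CompactSpace Y]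
    [TopologicalSpace.MetrizableSpace Y] [MeasurableSpace Y] [BorelSpace Y] {σ : Y → Y} {x : Y}
    {K : Set (ProbabilityMeasure Y)} (hK : IsCompact K) {α : ℕ → ProbabilityMeasure Y}
    (hα : ∀ j, α j ∈ K) (hdense : ∀ μ ∈ K, ∃ s : ℕ → ℕ, StrictMono s ∧ Tendsto (α ∘ s) atTop (𝓝 μ))
    {J E : ℕ → ℕ} (hE : StrictMono E) (hJE : ∀ j, J (E j) = j)
    (h : ∀ f : C(Y, ℝ), Tendsto (fun N => birkAvg σ (fun y => f y) N x -
      ∫ y, f y ∂(α (J N)).toMeasure) atTop (𝓝 0)) : limitPts σ x = K := by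
  have hcont : ∀ {u : ℕ → ProbabilityMeasure Y} {μ : ProbabilityMeasure Y},
      Tendsto u atTop (𝓝 μ) → ∀ f : C(Y, ℝ),
      Tendsto (fun k => ∫ y, f y ∂(u k).toMeasure) atTop (𝓝 (∫ y, f y ∂μ.toMeasure)) :=
    fun hu f => ProbabilityMeasure.tendsto_iff_forall_integral_tendsto.1 hu
      (BoundedContinuousFunction.mkOfCompact f)
  ext μ
  constructor
  · rintro ⟨n, hn, hlim⟩
    obtain ⟨ν, hν, s, hs, hνlim⟩ := hK.tendsto_subseq fun k => hα (J (n k))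
    have hμlim : Tendsto ((fun k => α (J (n k))) ∘ s) atTop (𝓝 μ) := by
      rw [ProbabilityMeasure.tendsto_iff_forall_integral_tendsto]
      intro f
      have h1 := (hlim f.toContinuousMap).comp hs.tendsto_atTop
      have h2 := (h f.toContinuousMap).comp (hn.comp hs).tendsto_atTop
      have h3 := h1.sub h2
      simpa using h3
    rwa [tendsto_nhds_unique hμlim hνlim]
  · intro hμ
    obtain ⟨s, hs, hlim⟩ := hdense μ hμ
    refine ⟨E ∘ s, hE.comp hs, fun f => ?_⟩
    have h1 := (h f).comp (hE.comp hs).tendsto_atTop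
    have h2 := hcont hlim f
    have h3 := h1.add h2
    simp only [Function.comp_apply, hJE, zero_add, sub_add_cancel] at h3
    exact h3

variable {B : Type} [Fintype B] [TopologicalSpace B] [DiscreteTopology B] [MeasurableSpace B]
  [BorelSpace B] {X : Set (ℕ → B)}

theorem birkAvg_sum {Y ι : Type*} (σ : Y → Y) (s : Finset ι) (c : ι → ℝ) (f : ι → Y → ℝ) (n : ℕ)
    (x : Y) :
    birkAvg σ (fun y => ∑ i ∈ s, c i * f i y) n x = ∑ i ∈ s, c i * birkAvg σ (f i) n x := by
  simp only [birkAvg, birkhoff]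
  rw [Finset.sum_comm, Finset.mul_sum]
  refine Finset.sum_congr rfl fun i _ => ?_
  rw [← Finset.mul_sum]; ring

theorem abs_birkAvg_sub_le {Y : Type*} (σ : Y → Y) {f g : Y → ℝ} {ε : ℝ} (hε : 0 ≤ ε)
    (h : ∀ y, |f y - g y| ≤ ε) (n : ℕ) (x : Y) : |birkAvg σ f n x - birkAvg σ g n x| ≤ ε := by
  rcases n.eq_zero_or_pos with rfl | hn
  · simpa [birkAvg] using hε
  have h1 : |birkhoff σ f n x - birkhoff σ g n x| ≤ n * ε := by
    rw [birkhoff, birkhoff, ← Finset.sum_sub_distrib]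
    calc _ ≤ ∑ i ∈ Finset.range n, ε :=
          (Finset.abs_sum_le_sum_abs _ _).trans (Finset.sum_le_sum fun i _ => h _)
      _ = _ := by simp
  have hn' : (0 : ℝ) < n := by exact_mod_cast hn
  rwa [birkAvg, birkAvg, ← mul_sub, abs_mul, abs_of_pos (inv_pos.2 hn'), inv_mul_le_iff₀ hn']

theorem LocalFn.integrable_ev (F : LocalFn B) (μ : ProbabilityMeasure ↥X) :
    Integrable (fun x : ↥X => F.ev x.val) μ.toMeasure :=
  integrable_prefixWord μ.toMeasure F.k F.toFun

theorem LocalFn.abs_integral_ev_le (F : LocalFn B) (μ : ProbabilityMeasure ↥X) :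
    |∫ x, F.ev x.val ∂μ.toMeasure| ≤ F.C := by
  have := norm_integral_le_of_norm_le_const (μ := μ.toMeasure) (C := F.C)
    (f := fun x => F.ev x.val) (Eventually.of_forall fun x => F.abs_toFun_le (prefixWord x.val F.k))
  simpa using this

theorem tendsto_birkAvg_sub_of_ind (hXcl : IsClosed X) {x : ↥X} {ν : ℕ → ProbabilityMeasure ↥X}
    (h : ∀ u : List B, Tendsto (fun N =>
      birkAvg (subShift X) (fun y => (LocalFn.ind u).ev y.val) N x -
      ∫ y, (LocalFn.ind u).ev y.val ∂(ν N).toMeasure) atTop (𝓝 0)) (f : C(↥X, ℝ)) :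
    Tendsto (fun N => birkAvg (subShift X) (fun y => f y) N x - ∫ y, f y ∂(ν N).toMeasure)
      atTop (𝓝 0) := by
  have : CompactSpace ↥X := isCompact_iff_compactSpace.1 hXcl.isCompact
  have hlocal : ∀ k c, Tendsto (fun N => birkAvg (subShift X)
      (fun y => (LocalFn.ofValues k c).ev y.val) N x -
        ∫ y, (LocalFn.ofValues k c).ev y.val ∂(ν N).toMeasure) atTop (𝓝 0) := by
    intro k c
    have h1 := tendsto_finsetSum (words B k) fun u _ => (h u).const_mul (c u)
    simp only [mul_zero, Finset.sum_const_zero] at h1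
    refine h1.congr fun N => ?_
    simp only [LocalFn.ofValues_ev_eq_sum]
    rw [birkAvg_sum, integral_finsetSum _ fun u _ => ((LocalFn.ind u).integrable_ev _).const_mul _]
    simp only [integral_const_mul, mul_sub, Finset.sum_sub_distrib]
  rw [Metric.tendsto_atTop]
  intro ε hε
  obtain ⟨k, c, hc⟩ := exists_localFn_approx hXcl f.continuous (show 0 < ε / 3 by positivity)
  obtain ⟨N0, hN0⟩ := Metric.tendsto_atTop.1 (hlocal k c) (ε / 3) (by positivity)
  refine ⟨N0, fun N hN => ?_⟩
  have h1 := hN0 N hN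
  rw [Real.dist_eq, sub_zero] at h1 ⊢
  have h2 := abs_le.1 (abs_birkAvg_sub_le (subShift X) (by positivity) hc N x)
  have hfi : Integrable (fun y => f y) (ν N).toMeasure :=
    f.continuous.integrable_of_hasCompactSupport (HasCompactSupport.of_compactSpace _)
  have h3 : |∫ y, f y ∂(ν N).toMeasure - ∫ y, (LocalFn.ofValues k c).ev y.val ∂(ν N).toMeasure|
      ≤ ε / 3 := by
    rw [← integral_sub hfi ((LocalFn.ofValues k c).integrable_ev _)]
    have := norm_integral_le_of_norm_le_const (μ := (ν N).toMeasure) (C := ε / 3)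
      (f := fun y => f y - (LocalFn.ofValues k c).ev y.val) (Eventually.of_forall hc)
    simpa using this
  have h3 := abs_le.1 h3
  have h1 := abs_lt.1 h1
  rw [abs_lt]; constructor <;> linarith

end Saturation

section MassDistribution

theorem exists_uniform_measure_pi (α : ℕ → Type*) [∀ i, Fintype (α i)] [∀ i, Nonempty (α i)] :
    ∃ (_ : MeasurableSpace (∀ i, α i)) (P : Measure (∀ i, α i)), IsProbabilityMeasure P ∧
      ∀ (l : ℕ) (z : ∀ i, α i), P {ω | ∀ i < l, ω i = z i} ≤
        ∏ i ∈ Finset.range l, ((Fintype.card (α i) : ℝ≥0∞))⁻¹ := by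
  let _ : ∀ i, MeasurableSpace (α i) := fun _ => ⊤
  have : ∀ i, MeasurableSingletonClass (α i) := fun _ => ⟨fun _ => trivial⟩
  have : ∀ i, IsProbabilityMeasure (ProbabilityTheory.uniformOn (univ : Set (α i))) := fun i =>
    ProbabilityTheory.isProbabilityMeasure_uniformOn finite_univ univ_nonempty
  refine ⟨inferInstance, Measure.infinitePi fun i => ProbabilityTheory.uniformOn (univ : Set (α i)),
    inferInstance, fun l z => ?_⟩
  have e : {ω : ∀ i, α i | ∀ i < l, ω i = z i} =
      ((Finset.range l : Finset ℕ) : Set ℕ).pi fun i => {z i} := by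
    ext ω; simp [Set.mem_pi]
  rw [e, Measure.infinitePi_pi _ fun i _ => measurableSet_singleton _]
  refine (Finset.prod_congr rfl fun i _ => ?_).le
  rw [ProbabilityTheory.uniformOn_univ, Measure.count_singleton, one_div]

namespace Scheme

variable {B : Type} [Fintype B] {G : Set (List B)} {τ : ℕ} {S : Scheme G τ}

theorem measure_follows_le {m : MeasurableSpace (∀ l, ↥(S.T (S.jj l)))}
    {P : Measure (∀ l, ↥(S.T (S.jj l)))}
    (hP : ∀ (l : ℕ) (z : ∀ l, ↥(S.T (S.jj l))), P {ω | ∀ i < l, ω i = z i} ≤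
        ∏ i ∈ Finset.range l, ((Fintype.card ↥(S.T (S.jj i)) : ℝ≥0∞))⁻¹)
    {η : ℕ → ℝ} (hη : ∀ j, Real.exp (S.n j * η j) ≤ (S.T j).card)
    {x : (∀ l, ↥(S.T (S.jj l))) → ℕ → B} (hx : ∀ ω, S.Follows (x ω) fun l => (ω l).val)
    {ξ : ℝ} (hξ : 0 < ξ) (hξ1 : ξ ≤ 1) (w : List B) :
    P {ω | x ω ∈ cylinder w} ≤ ENNReal.ofReal (Real.exp (
      S.err (S.level w.length) * (-Real.log ξ) +
      (w.length + S.tot (S.level w.length)) * ((Fintype.card B + 1) * ξ) -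
      ∑ i ∈ Finset.range (S.level w.length), S.n (S.jj i) * η (S.jj i))) := by
  set l := S.level w.length with hl
  set V := (words B (S.tot l)).filter fun Z => Align w Z (S.err l) with hV
  have hsub : {ω | x ω ∈ cylinder w} ⊆
      ⋃ Z ∈ V, {ω : ∀ l, ↥(S.T (S.jj l)) | cat (fun l => (ω l).val) l = Z} := by
    intro ω hω
    simp only [mem_iUnion]
    have h1 := hx ω w.length
    rw [mem_cylinder_iff.1 hω] at h1
    refine ⟨_, ?_, rfl⟩
    rw [hV, Finset.mem_filter, mem_words]
    exact ⟨length_cat_eq (fun l => (ω l).2) _, h1⟩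
  set p : ℝ := ∏ i ∈ Finset.range l, Real.exp (-(S.n (S.jj i) * η (S.jj i))) with hp
  have hZ : ∀ Z, P {ω | cat (fun l => (ω l).val) l = Z} ≤ ENNReal.ofReal p := by
    intro Z
    rcases {ω : ∀ l, ↥(S.T (S.jj l)) | cat (fun l => (ω l).val) l = Z}.eq_empty_or_nonempty
      with h | ⟨z, hz⟩
    · rw [h, measure_empty]; exact zero_le
    · refine (measure_mono fun ω hω => ?_).trans ((hP l z).trans ?_)
      · intro i hi
        apply Subtype.ext
        refine eq_of_cat_eq (fun i _ => ?_) (hω.trans hz.symm) i hi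
        rw [S.length_eq _ _ (ω i).2, S.length_eq _ _ (z i).2]
      · rw [hp, ENNReal.ofReal_prod_of_nonneg fun _ _ => (Real.exp_pos _).le]
        refine Finset.prod_le_prod' fun i _ => ?_
        rw [Real.exp_neg, ENNReal.ofReal_inv_of_pos (Real.exp_pos _), Fintype.card_coe]
        refine ENNReal.inv_le_inv.2 ?_
        rw [← ENNReal.ofReal_natCast]
        exact ENNReal.ofReal_le_ofReal (hη _)
  have hcard : (V.card : ℝ) ≤ Real.exp (S.err l * (-Real.log ξ) +
      (w.length + S.tot l) * ((Fintype.card B + 1) * ξ)) := by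
    have h1 := card_align_le hξ hξ1 w (S.tot l) (S.err l)
    have h2 : (1 + ((Fintype.card B : ℝ) + 1) * ξ) ^ (w.length + S.tot l) ≤
        Real.exp ((w.length + S.tot l) * ((Fintype.card B + 1) * ξ)) := by
      have h3 : 1 + ((Fintype.card B : ℝ) + 1) * ξ ≤ Real.exp ((Fintype.card B + 1) * ξ) := by
        linarith [Real.add_one_le_exp (((Fintype.card B : ℝ) + 1) * ξ)]
      refine (pow_le_pow_left₀ (by positivity) h3 _).trans_eq ?_
      rw [← Real.exp_nat_mul]; push_cast; rfl
    rw [Real.exp_add, mul_neg, Real.exp_neg, Real.exp_nat_mul, Real.exp_log hξ,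
      ← div_eq_inv_mul, le_div_iff₀ (by positivity)]
    exact h1.trans h2
  have hp0 : 0 ≤ p := Finset.prod_nonneg fun _ _ => (Real.exp_pos _).le
  calc P {ω | x ω ∈ cylinder w}
      ≤ ∑ Z ∈ V, P {ω | cat (fun l => (ω l).val) l = Z} :=
        (measure_mono hsub).trans (measure_biUnion_finset_le _ _)
    _ ≤ ∑ Z ∈ V, ENNReal.ofReal p := Finset.sum_le_sum fun Z _ => hZ Z
    _ = ENNReal.ofReal (V.card * p) := by
        rw [Finset.sum_const, nsmul_eq_mul, ENNReal.ofReal_mul (Nat.cast_nonneg _),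
          ENNReal.ofReal_natCast]
    _ ≤ _ := by
        refine ENNReal.ofReal_le_ofReal ?_
        rw [sub_eq_add_neg, Real.exp_add, ← Finset.sum_neg_distrib, Real.exp_sum, ← hp]
        exact mul_le_mul_of_nonneg_right hcard hp0

theorem mcalLim_ne_zero [TopologicalSpace B] [DiscreteTopology B] {X : Set (ℕ → B)}
    (hX : MapsTo shift X X) {φ : ↥X → ℝ} {b : ℝ} (hb : ∀ x, φ x ≤ b) {Z : Set ↥X}
    {η I : ℕ → ℝ} (hη : ∀ j, Real.exp (S.n j * η j) ≤ (S.T j).card)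
    (F : LocalFn B) {ε : ℝ} (hε : 0 < ε) (hF : ∀ x : ↥X, |φ x - F.ev x.val| ≤ ε)
    (hI : ∀ j, ∀ W ∈ S.T j, ∀ u, |F.bsum (u ++ W) - F.bsum u - S.n j * I j| ≤ ε * S.n j)
    {s t : ℝ} (hs : ∀ j, s ≤ η j + I j) (hst : t + 4 * ε < s)
    (hZ : ∀ W : ℕ → List B, (∀ l, W l ∈ S.T (S.jj l)) → ∃ x ∈ Z, S.Follows x.val W) :
    McalLim X φ Z t ≠ 0 := by
  choose x hxZ hx using fun ω : ∀ l, ↥(S.T (S.jj l)) => hZ (fun l => (ω l).val) fun l => (ω l).2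
  have : ∀ l, Nonempty ↥(S.T (S.jj l)) := fun l => (S.nonempty _).to_subtype
  obtain ⟨m, P, hP1, hP⟩ := exists_uniform_measure_pi fun l => ↥(S.T (S.jj l))
  have hC := F.C_nonneg
  set ξ : ℝ := min 1 (ε / (Fintype.card B + 1)) with hξdef
  have hξ : 0 < ξ := lt_min one_pos (by positivity)
  have hξ1 : ξ ≤ 1 := min_le_left _ _
  have hξε : ((Fintype.card B : ℝ) + 1) * ξ ≤ ε := by
    rw [← le_div_iff₀' (by positivity)]; exact min_le_right _ _
  set M : ℝ := |s| + F.C * (4 * F.k + 1) + (-Real.log ξ) with hM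
  have hlim : Tendsto (fun N : ℕ => (M * S.err (S.level N) + 2 * F.C * F.k) / N) atTop (𝓝 0) := by
    have h1 := ((S.isLittleO_comp_level S.isLittleO_err).tendsto_div_nhds_zero).const_mul M
    have h2 := tendsto_const_div_atTop_nhds_zero_nat (2 * F.C * F.k)
    have h3 := h1.add h2
    simp only [mul_zero, add_zero] at h3
    refine h3.congr fun N => ?_
    ring
  obtain ⟨N0, hN0⟩ := eventually_atTop.1
    (hlim.eventually_le_const (show (0 : ℝ) < s - t - 4 * ε by linarith))
  have hbound : ∀ w : List B, N0 < w.length → P {ω | (x ω).val ∈ cylinder w} ≤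
      ENNReal.ofReal (Real.exp (-t * w.length + sSup (birkhoff (subShift X) φ w.length ''
        (Subtype.val ⁻¹' cylinder w)))) := by
    intro w hw
    rcases {ω | (x ω).val ∈ cylinder w}.eq_empty_or_nonempty with h | ⟨ω, hω⟩
    · rw [h, measure_empty]; exact zero_le
    refine (measure_follows_le (x := fun ω => (x ω).val) hP hη hx hξ hξ1 w).trans ?_
    refine ENNReal.ofReal_le_ofReal (Real.exp_le_exp.2 ?_)
    have hsup : birkhoff (subShift X) φ w.length (x ω) ≤
        sSup (birkhoff (subShift X) φ w.length '' (Subtype.val ⁻¹' cylinder w)) := by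
      refine le_csSup ⟨w.length * b, ?_⟩ ⟨x ω, hω, rfl⟩
      rintro _ ⟨y, -, rfl⟩
      calc birkhoff (subShift X) φ w.length y ≤ ∑ i ∈ Finset.range w.length, b :=
            Finset.sum_le_sum fun _ _ => hb _
        _ = _ := by simp
    refine le_trans ?_ (add_le_add_right hsup _)
    have h1 := hN0 w.length hw.le
    have hwpos : (0 : ℝ) < w.length := by exact_mod_cast (Nat.zero_le _).trans_lt hw
    rw [div_le_iff₀ hwpos] at h1
    set l := S.level w.length with hl
    have h2 : birkhoff (subShift X) (fun y => F.ev y.val) w.length (x ω) - ε * w.length ≤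
        birkhoff (subShift X) φ w.length (x ω) := by
      have : ∑ i ∈ Finset.range w.length, ε = ε * w.length := by simp [mul_comm]
      rw [birkhoff, birkhoff, ← this, ← Finset.sum_sub_distrib]
      refine Finset.sum_le_sum fun i _ => ?_
      have := abs_le.1 (hF ((subShift X)^[i] (x ω)))
      linarith
    have h3 := abs_le.1 (abs_birkhoff_sub_bsum_le hX F (x ω) w.length)
    have h4 := abs_le.1 (F.abs_bsum_sub_le_of_align (hx ω w.length))
    have h5 := abs_le.1 (abs_bsum_cat_sub_le (S := S) F (W := fun l => (ω l).val) (I := I)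
      (ε := fun _ => ε) (l := l) fun i _ u => hI _ _ (ω i).2 u)
    have htot : ((S.tot l : ℕ) : ℝ) = ∑ i ∈ Finset.range l, (S.n (S.jj i) : ℝ) := by
      simp [tot, totLen]
    have h6 : ∑ i ∈ Finset.range l, ε * (S.n (S.jj i) : ℝ) = ε * S.tot l := by
      rw [htot, Finset.mul_sum]
    have h7 : s * S.tot l ≤ ∑ i ∈ Finset.range l, (S.n (S.jj i) : ℝ) * η (S.jj i) +
        ∑ i ∈ Finset.range l, (S.n (S.jj i) : ℝ) * I (S.jj i) := by
      rw [htot, Finset.mul_sum, ← Finset.sum_add_distrib]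
      refine Finset.sum_le_sum fun i _ => ?_
      rw [← mul_add, mul_comm s]
      exact mul_le_mul_of_nonneg_left (hs _) (Nat.cast_nonneg _)
    have h8 : (S.tot l : ℝ) ≤ w.length := by exact_mod_cast S.tot_level_le w.length
    have h9 : (w.length : ℝ) ≤ S.tot l + S.err l := by
      exact_mod_cast S.le_tot_level_add w.length
    have h10 : s * w.length - |s| * S.err l ≤ s * S.tot l := by
      have : |s * (w.length - S.tot l)| ≤ |s| * S.err l := by
        rw [abs_mul, abs_of_nonneg (sub_nonneg.2 h8)]
        exact mul_le_mul_of_nonneg_left (by linarith) (abs_nonneg _)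
      have := le_of_abs_le this
      linarith
    have h11 : ((w.length : ℝ) + S.tot l) * ((Fintype.card B + 1) * ξ) ≤
        (w.length + w.length) * ε :=
      mul_le_mul (by linarith) hξε (by positivity) (by positivity)
    have h12 : ε * S.tot l ≤ ε * w.length := mul_le_mul_of_nonneg_left h8 hε.le
    rw [h6] at h5
    rw [hM] at h1
    have h13 := h4.1
    have h14 := h5.1
    have h15 := h3.1
    nlinarith
  have hone : 1 ≤ Mcal X φ Z t N0 := by
    refine le_iInf₂ fun Sw hSw => le_iInf₂ fun hlen hcov => ?_
    calc (1 : ℝ≥0∞) = P univ := measure_univ.symm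
      _ ≤ P (⋃ w ∈ Sw, {ω | (x ω).val ∈ cylinder w}) := by
          refine measure_mono fun ω _ => ?_
          have := hcov (hxZ ω)
          simpa only [mem_iUnion, mem_preimage, mem_ofPred_eq] using this
      _ ≤ ∑' w : Sw, P {ω | (x ω).val ∈ cylinder w.val} := measure_biUnion_le _ hSw _
      _ ≤ _ := ENNReal.tsum_le_tsum fun w => hbound _ (hlen _ w.2)
  have : 1 ≤ McalLim X φ Z t := hone.trans (le_iSup (fun N => Mcal X φ Z t N) N0)
  exact (one_pos.trans_le this).ne'

end Scheme

end MassDistribution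

section LowerBound

variable {B : Type} [Fintype B] [TopologicalSpace B] [DiscreteTopology B] [MeasurableSpace B]
  [BorelSpace B] {X : Set (ℕ → B)}

theorem exists_scheme (hX : MapsTo shift X X) {α : ℕ → ProbabilityMeasure ↥X}
    (hα : ∀ j, IsInvariant (subShift X) (α j)) {G : Set (List B)} {τ : ℕ} {g : ℕ → ℕ}
    (hg : Tendsto (fun n => (g n : ℝ) / n) atTop (𝓝 0))
    (hG : ∀ v ∈ G, ∀ w ∈ G, ∃ u : List B, u.length ≤ τ ∧ v ++ u ++ w ∈ G)
    (happ : ∀ w ∈ language X, ∃ v ∈ G, editDist v w ≤ g w.length)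
    (F : ℕ → LocalFn B) {ε : ℕ → ℝ} (hε : ∀ j, 0 < ε j) (hε0 : Tendsto ε atTop (𝓝 0)) :
    ∃ S : Scheme G τ, (∀ j, Real.exp (S.n j * (entropy X (α j) - ε j)) ≤ (S.T j).card) ∧
      ∀ j, ∀ W ∈ S.T j, ∀ i ≤ j, ∀ u, |(F i).bsum (u ++ W) - (F i).bsum u -
        S.n j * ∫ x, (F i).ev x.val ∂(α j).toMeasure| ≤ ε j * S.n j := by
  choose n d T hn hT hlen hcard htrack hnear hd using fun j =>
    exists_blocks hX (α j) (hα j) hg hG happ (fun i : Fin (j + 1) => F i) (hε j)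
  obtain ⟨L, jj, hst, hdom⟩ := exists_schedule hn
  refine ⟨⟨n, d, T, L, jj, hn, hT, hlen, hnear, ?_, hst, hdom⟩, hcard, fun j W hW i hi u => ?_⟩
  · have h1 : (fun j => ε j * (n j : ℝ)) =o[atTop] fun j => (n j : ℝ) := by
      have := ((Asymptotics.isLittleO_one_iff ℝ).2 hε0).mul_isBigO
        (Asymptotics.isBigO_refl (fun j => (n j : ℝ)) atTop)
      simpa using this
    refine Asymptotics.IsBigO.trans_isLittleO (Asymptotics.IsBigO.of_bound 1 ?_) h1
    refine Eventually.of_forall fun j => ?_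
    rw [one_mul, Real.norm_natCast]
    exact (hd j).trans (le_abs_self _)
  · exact htrack j W hW ⟨i, by omega⟩ u

theorem Scheme.Follows.mem_saturated (hXcl : IsClosed X) (hX : MapsTo shift X X)
    {K : Set (ProbabilityMeasure ↥X)} (hK : IsCompact K) {α : ℕ → ProbabilityMeasure ↥X}
    (hαK : ∀ j, α j ∈ K) (hα : ∀ f : C(↥X, ℝ), Tendsto (fun j => ∫ x, f x ∂(α (j + 1)).toMeasure -
      ∫ x, f x ∂(α j).toMeasure) atTop (𝓝 0))
    (hdense : ∀ μ ∈ K, ∃ s : ℕ → ℕ, StrictMono s ∧ Tendsto (α ∘ s) atTop (𝓝 μ))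
    {G : Set (List B)} {τ : ℕ} {S : Scheme G τ} {ε : ℕ → ℝ} (hε0 : Tendsto ε atTop (𝓝 0))
    (hS : ∀ v : List B, ∀ᶠ j in atTop, ∀ W ∈ S.T j, ∀ u, |(LocalFn.ind v).bsum (u ++ W) -
      (LocalFn.ind v).bsum u - S.n j * ∫ x, (LocalFn.ind v).ev x.val ∂(α j).toMeasure| ≤
        ε j * S.n j)
    {x : ↥X} {W : ℕ → List B} (hW : ∀ l, W l ∈ S.T (S.jj l)) (hx : S.Follows x.val W) :
    x ∈ saturated (subShift X) K := by
  have : CompactSpace ↥X := isCompact_iff_compactSpace.1 hXcl.isCompact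
  have hsm : StrictMono fun l => S.tot l + S.cost l := S.stages_level.strictMono
  refine limitPts_eq_of_tendsto hK hαK hdense (J := fun N => S.jj (S.level N))
    (E := fun j => S.tot (S.L j) + S.cost (S.L j)) (hsm.comp S.stages.strictMono) (fun j => ?_) ?_
  · rw [S.stages_level.apply_start, S.stages.apply_start]
  · refine tendsto_birkAvg_sub_of_ind hXcl fun v => ?_
    have hI : ∀ j, |∫ x, (LocalFn.ind v).ev x.val ∂(α j).toMeasure| ≤ (LocalFn.ind v).C :=
      fun j => (LocalFn.ind v).abs_integral_ev_le _
    refine hx.isLittleO_birkhoff hX (LocalFn.ind v)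
      (I := fun j => ∫ x, (LocalFn.ind v).ev x.val ∂(α j).toMeasure) hI ?_
    refine Scheme.isLittleO_bsum_cat_sub (LocalFn.ind v) hε0 hI
      (hα ⟨_, (LocalFn.ind v).continuous_ev⟩) ?_
    filter_upwards [S.stages.tendsto.eventually (hS v)] with l hl u
    exact hl _ (hW l) u

theorem mcalLim_saturated_ne_zero (hXcl : IsClosed X) (hX : MapsTo shift X X) {φ : ↥X → ℝ}
    (hφ : Continuous φ) {G : Set (List B)} (hGX : G ⊆ language X)
    (hspec : HasSpecW (language X) G) (happ : EditApproachable (language X) G)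
    {K : Set (ProbabilityMeasure ↥X)} (hK : IsCompact K) (hK' : IsConnected K)
    (hKinv : ∀ μ ∈ K, IsInvariant (subShift X) μ) {s t : ℝ}
    (hs : ∀ μ ∈ K, s ≤ entropy X μ + ∫ x, φ x ∂μ.toMeasure) (hst : t < s) :
    McalLim X φ (saturated (subShift X) K) t ≠ 0 := by
  have : CompactSpace ↥X := isCompact_iff_compactSpace.1 hXcl.isCompact
  obtain ⟨τ, hτ⟩ := hspec
  obtain ⟨g, ⟨-, hg⟩, happ⟩ := happ
  have hG : ∀ v ∈ G, ∀ w ∈ G, ∃ u : List B, u.length ≤ τ ∧ v ++ u ++ w ∈ G := fun v hv w hw =>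
    let ⟨u, _, h⟩ := hτ v hv w hw
    ⟨u, h⟩
  obtain ⟨μ0, hμ0⟩ := hK'.nonempty
  have hXne : Nonempty ↥X := μ0.toMeasure.nonempty_of_neZero
  have hGne : G.Nonempty := by
    obtain ⟨x⟩ := hXne
    obtain ⟨v, hv, -⟩ := happ (prefixWord x.val 0) ⟨x, mem_cylinder_prefixWord _ _, x.2⟩
    exact ⟨v, hv⟩
  obtain ⟨α, hαK, hαslow, hαdense⟩ := exists_slow_dense_sequence_of_isConnected hK hK'
  have hα : ∀ f : C(↥X, ℝ), Tendsto (fun j => ∫ x, f x ∂(α (j + 1)).toMeasure -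
      ∫ x, f x ∂(α j).toMeasure) atTop (𝓝 0) := fun f =>
    hαslow (fun μ => ∫ x, f x ∂μ.toMeasure) <| continuous_iff_continuousAt.2 fun μ =>
      ProbabilityMeasure.tendsto_iff_forall_integral_tendsto.1 tendsto_id
        (BoundedContinuousFunction.mkOfCompact f)
  set ε : ℝ := (s - t) / 12 with hεdef
  have hε : 0 < ε := by rw [hεdef]; linarith
  obtain ⟨k, c, hc⟩ := exists_localFn_approx hXcl hφ hε
  set F0 := LocalFn.ofValues k c with hF0
  obtain ⟨w, hw⟩ := exists_surjective_nat (List B)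
  let F : ℕ → LocalFn B := fun i => Nat.casesOn i F0 fun i => LocalFn.ind (w i)
  let εs : ℕ → ℝ := fun j => min ε (1 / ((j : ℝ) + 1))
  have hεs : ∀ j, 0 < εs j := fun j => lt_min hε (by positivity)
  have hεs0 : Tendsto εs atTop (𝓝 0) :=
    squeeze_zero (fun j => (hεs j).le) (fun j => min_le_right _ _)
      tendsto_one_div_add_atTop_nhds_zero_nat
  obtain ⟨S, hcard, htrack⟩ := exists_scheme hX (fun j => hKinv _ (hαK j)) hg hG happ F hεs hεs0
  have hpos : ∀ j, (0 : ℝ) ≤ S.n j := fun j => Nat.cast_nonneg _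
  obtain ⟨b, hb⟩ := (isCompact_range hφ).bddAbove
  refine Scheme.mcalLim_ne_zero (S := S) hX (b := b) (fun x => hb (mem_range_self x))
    (η := fun j => entropy X (α j) - ε)
    (I := fun j => ∫ x, F0.ev x.val ∂(α j).toMeasure) (fun j => ?_) F0 hε hc
    (fun j W hW u => ?_) (s := s - 2 * ε) (fun j => ?_) (by rw [hεdef]; linarith) fun W hW => ?_
  · refine le_trans (Real.exp_le_exp.2 ?_) (hcard j)
    exact mul_le_mul_of_nonneg_left (sub_le_sub_left (min_le_left _ _) _) (hpos j)
  · exact (htrack j W hW 0 (Nat.zero_le _) u).trans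
      (mul_le_mul_of_nonneg_right (min_le_left _ _) (hpos j))
  · have h1 := hs _ (hαK j)
    have hfi : Integrable φ (α j).toMeasure :=
      hφ.integrable_of_hasCompactSupport (HasCompactSupport.of_compactSpace _)
    have h2 := norm_integral_le_of_norm_le_const (μ := (α j).toMeasure) (C := ε)
      (f := fun x => φ x - F0.ev x.val) (Eventually.of_forall hc)
    rw [integral_sub hfi (F0.integrable_ev _)] at h2
    simp only [probReal_univ, mul_one] at h2
    have h3 := le_of_abs_le h2
    linarith
  · obtain ⟨x, hx⟩ := S.exists_follows hXcl hX hGX hGne hG hW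
    refine ⟨x, Scheme.Follows.mem_saturated hXcl hX hK hαK hα hαdense hεs0 (fun v => ?_) hW hx, hx⟩
    obtain ⟨i, rfl⟩ := hw v
    filter_upwards [eventually_ge_atTop (i + 1)] with j hj W hW u
    exact htrack j W hW (i + 1) hj u

theorem pressure_saturated (hXcl : IsClosed X) (hX : MapsTo shift X X) {φ : ↥X → ℝ}
    (hφ : Continuous φ) {G : Set (List B)} (hGX : G ⊆ language X)
    (hspec : HasSpecW (language X) G) (happ : EditApproachable (language X) G)
    {K : Set (ProbabilityMeasure ↥X)} (hK : IsCompact K) (hK' : IsConnected K)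
    (hKinv : ∀ μ ∈ K, IsInvariant (subShift X) μ) :
    pressure X φ (saturated (subShift X) K) =
      sInf ((fun μ : ProbabilityMeasure ↥X => entropy X μ + ∫ x, φ x ∂μ.toMeasure) '' K) := by
  have : CompactSpace ↥X := isCompact_iff_compactSpace.1 hXcl.isCompact
  set s := sInf ((fun μ : ProbabilityMeasure ↥X => entropy X μ + ∫ x, φ x ∂μ.toMeasure) '' K)
    with hs
  obtain ⟨b, hb⟩ := (isCompact_range hφ).bddBelow
  have hbdd : BddBelow
      ((fun μ : ProbabilityMeasure ↥X => entropy X μ + ∫ x, φ x ∂μ.toMeasure) '' K) := by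
    refine ⟨b, ?_⟩
    rintro _ ⟨μ, -, rfl⟩
    have h1 := entropy_nonneg μ
    have hfi : Integrable φ μ.toMeasure :=
      hφ.integrable_of_hasCompactSupport (HasCompactSupport.of_compactSpace _)
    have h2 : b ≤ ∫ x, φ x ∂μ.toMeasure := by
      have := integral_mono (μ := μ.toMeasure) (integrable_const b) hfi
        fun x => hb (mem_range_self x)
      simpa using this
    exact h2.trans (le_add_of_nonneg_left h1)
  have hupper : ∀ t, s < t → McalLim X φ (saturated (subShift X) K) t = 0 := by
    intro t ht
    obtain ⟨_, ⟨μ, hμ, rfl⟩, hμt⟩ := exists_lt_of_csInf_lt (hK'.nonempty.image _) ht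
    exact mcalLim_eq_zero hXcl hX hφ μ (fun x hx => (hx : limitPts _ x = K) ▸ hμ) hμt
  have hlower : ∀ t, McalLim X φ (saturated (subShift X) K) t = 0 → s ≤ t := by
    intro t ht
    by_contra! hst
    exact mcalLim_saturated_ne_zero hXcl hX hφ hGX hspec happ hK hK' hKinv
      (fun μ hμ => csInf_le hbdd ⟨μ, hμ, rfl⟩) hst ht
  refine le_antisymm (le_of_forall_gt_imp_ge_of_dense fun t ht => ?_) ?_
  · exact csInf_le ⟨s, hlower⟩ (hupper t ht)
  · exact le_csInf ⟨s + 1, hupper _ (by linarith)⟩ hlower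

end LowerBound

/-- conditional variational principle for the pressure of the saturated set. -/
theorem statement_0 {A : Type} [Fintype A] [DecidableEq A] [TopologicalSpace A]
    [DiscreteTopology A] [MeasurableSpace A] [BorelSpace A]
    (X : Set (ℕ → A)) (hXcl : IsClosed X) (hXinv : Set.MapsTo shift X X)
    (φ : ↥X → ℝ) (hφ : Continuous φ)
    (G : Set (List A)) (hG : G ⊆ language X)
    (hspec : HasSpecW (language X) G) (happ : EditApproachable (language X) G)
    (K : Set (ProbabilityMeasure ↥X)) (hKcpt : IsCompact K) (hKconn : IsConnected K)
    (hKinv : ∀ μ ∈ K, IsInvariant (subShift X) μ) :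
    pressure X φ (saturated (subShift X) K) =
      sInf ((fun μ : ProbabilityMeasure ↥X =>
        entropy X μ + ∫ x, φ x ∂μ.toMeasure) '' K) :=
  pressure_saturated hXcl hXinv hφ hG hspec happ hKcpt hKconn hKinv


end Paper
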